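/- arXiv:0709.1297 — 3 statements merged into one kernel-verified Lean document; each statement's English description precedes it below -/
import Mathlib

section
/- Let K be a field, G a finite group, and H a finite abelian group of exponent e (i.e. e = max{ord(h) : h ∈ H}). Assume K contains a primitive e-th root of unity. Set G̃ = H × G. Then there exists a K-embedding ι : K(G) → K(G̃) such that K(G̃) is rational (purely transcendental) over the subfield ι(K(G)). -/
set_option synthInstance.maxHeartbeats 1000000
set_option maxHeartbeats 1000000

noncomputable section

/-- The rational function field `K(x(g) : g ∈ G)` in variables indexed by `G`. -/
abbrev NoetherBigField (K : Type*) [Field K] (G : Type*) : Type _ :=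
  FractionRing (MvPolynomial G K)

/-- The `K`-automorphism of `K(x(g) : g ∈ G)` induced by `h · x(g) = x(hg)`. -/
def noetherAut (K : Type*) [Field K] (G : Type*) [Group G] (h : G) :
    NoetherBigField K G ≃ₐ[K] NoetherBigField K G :=
  IsFractionRing.algEquivOfAlgEquiv (MvPolynomial.renameEquiv K (Equiv.mulLeft h))

/-- The fixed field `K(G) = K(x(g) : g ∈ G)^G`, as a subfield. -/
def noetherSubfield (K : Type*) [Field K] (G : Type*) [Group G] :
    Subfield (NoetherBigField K G) where
  carrier := {x | ∀ h : G, noetherAut K G h x = x}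
  mul_mem' := by intro a b ha hb h; rw [map_mul, ha h, hb h]
  one_mem' := by intro h; rw [map_one]
  add_mem' := by intro a b ha hb h; rw [map_add, ha h, hb h]
  zero_mem' := by intro h; rw [map_zero]
  neg_mem' := by intro a ha h; rw [map_neg, ha h]
  inv_mem' := by intro a ha h; rw [map_inv₀, ha h]

/-- Noether's fixed field `K(G) = K(x(g) : g ∈ G)^G`. -/
def NoetherField (K : Type*) [Field K] (G : Type*) [Group G] : Type _ :=
  noetherSubfield K G

instance (K : Type*) [Field K] (G : Type*) [Group G] : Field (NoetherField K G) :=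
  inferInstanceAs (Field (noetherSubfield K G))

theorem algebraMap_mem_noetherSubfield (K : Type*) [Field K] (G : Type*) [Group G] (c : K) :
    algebraMap K (NoetherBigField K G) c ∈ noetherSubfield K G := by
  intro h
  exact AlgEquiv.commutes _ c

instance (K : Type*) [Field K] (G : Type*) [Group G] : Algebra K (NoetherField K G) :=
  RingHom.toAlgebra <|
    ((algebraMap K (NoetherBigField K G)).codRestrict (noetherSubfield K G).toSubring
      (algebraMap_mem_noetherSubfield K G))

/-- An extension `L/F` is rational (purely transcendental) if `L` is `F`-isomorphic to a
rational function field `F(t₁, …, tₙ)` over `F` in finitely many variables. -/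
def IsRationalExtension (F L : Type*) [Field F] [Field L] [Algebra F L] : Prop :=
  ∃ n : ℕ, Nonempty (L ≃ₐ[F] FractionRing (MvPolynomial (Fin n) F))

/-- An extension `L/F` is stably rational if the rational function field `L(y₁, …, y_r)`
is rational over `F` for some finite number `r` of indeterminates. -/
def IsStablyRationalExtension (F L : Type*) [Field F] [Field L] [Algebra F L] : Prop :=
  ∃ r : ℕ, IsRationalExtension F (FractionRing (MvPolynomial (Fin r) L))


lemma lat {I : Type*} [Finite I] (M : Submodule ℤ (I → ℤ)) :
    ∃ n : ℕ, n ≤ Nat.card I ∧ ∃ b : Fin n → (I → ℤ), Submodule.span ℤ (Set.range b) = M := by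
  classical
  have := Fintype.ofFinite I
  refine ⟨Module.finrank ℤ M, ?_, fun i => (Module.finBasis ℤ M i : I → ℤ), ?_⟩
  · have := Submodule.finrank_le M
    simpa using this
  · have h := (Module.finBasis ℤ M).span_eq
    have := congrArg (Submodule.map M.subtype) h
    rw [Submodule.map_span, ← Set.range_comp, Submodule.map_top, Submodule.range_subtype] at this
    exact this

theorem core {K F A E G H I : Type*} [Field K] [Field F] [Field A] [Field E]
    [Algebra K E] [Algebra F A] [Algebra A E] [Algebra F E] [IsScalarTower F A E]
    [Group G] [Finite G] [CommGroup H] [Finite H] [Finite I]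
    [MulSemiringAction G A] [MulSemiringAction (H × G) E]
    [Algebra.IsInvariant F A G]
    (hF : ∀ (g : G) (x : F), g • algebraMap F A x = algebraMap F A x)
    (hA : ∀ (h : H) (g : G) (x : A), (h, g) • algebraMap A E x = algebraMap A E (g • x))
    (a : A) (ha : ∀ [Fintype G], ∑ g : G, g • a = 1)
    (hH : (Nat.card H : E) ≠ 0)
    (z : I → E) (hz0 : ∀ i, z i ≠ 0) (c : I → (H →* Kˣ)) (e : ℕ) (he : 0 < e)
    (hce : ∀ (χ : H →* Kˣ) (h : H), (χ h) ^ e = 1)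
    (hz : ∀ h g i, ((h, g) : H × G) • z i = algebraMap K E (c i h) * z i)
    (htop : IntermediateField.adjoin A (Set.range z) = ⊤) :
    ∃ n : ℕ, n ≤ Nat.card I ∧ ∃ w : Fin n → E, (∀ i (γ : H × G), γ • w i = w i) ∧
      ∀ f : E, (∀ γ : H × G, γ • f = f) → f ∈ IntermediateField.adjoin F (Set.range w) := by
  classical
  have := Fintype.ofFinite G
  have := Fintype.ofFinite H
  have := Fintype.ofFinite I
  let mon : (I → ℤ) → E := fun m => ∏ i, z i ^ m i
  let ch : (I → ℤ) → (H → Kˣ) := fun m h => ∏ i, c i h ^ m i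
  have mon_add : ∀ m m', mon (m + m') = mon m * mon m' := by
    intro m m'
    simp only [mon, Pi.add_apply, zpow_add₀ (hz0 _), Finset.prod_mul_distrib]
  have mon_neg : ∀ m, mon (-m) = (mon m)⁻¹ := by
    intro m
    simp only [mon, Pi.neg_apply, zpow_neg, Finset.prod_inv_distrib]
  have mon_zero : mon 0 = 1 := by simp [mon]
  have ch_add : ∀ m m', ch (m + m') = ch m * ch m' := by
    intro m m'
    funext h
    simp only [ch, Pi.mul_apply, Pi.add_apply, zpow_add, Finset.prod_mul_distrib]
  have ch_neg : ∀ m, ch (-m) = (ch m)⁻¹ := by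
    intro m
    funext h
    simp only [ch, Pi.inv_apply, Pi.neg_apply, zpow_neg, Finset.prod_inv_distrib]
  have ch_zero : ch 0 = 1 := by funext h; simp [ch]
  have act : ∀ (h : H) (g : G) m, (h, g) • mon m = algebraMap K E (ch m h) * mon m := by
    intro h g m
    have : ∀ x : E, (h, g) • x = MulSemiringAction.toRingHom (H × G) E (h, g) x := fun _ => rfl
    simp only [mon]
    rw [this, map_prod]
    simp only [ch, Units.coe_prod, map_prod]
    rw [← Finset.prod_mul_distrib]
    refine Finset.prod_congr rfl fun i _ => ?_
    rw [map_zpow₀, ← this, hz, mul_zpow, ← map_zpow₀]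
    simp
  let M : AddSubgroup (I → ℤ) :=
    { carrier := {m | ch m = 1}
      add_mem' := by intro x y hx hy; simp only [Set.mem_ofPred_eq] at *; rw [ch_add, hx, hy, one_mul]
      zero_mem' := ch_zero
      neg_mem' := by intro x hx; simp only [Set.mem_ofPred_eq] at *; rw [ch_neg, hx, inv_one] }
  have hM : ∀ m, m ∈ M ↔ ch m = 1 := fun m => Iff.rfl
  obtain ⟨n, hn, b, hb⟩ := lat (AddSubgroup.toIntSubmodule M)
  refine ⟨n, hn, fun i => mon (b i), ?_, ?_⟩
  · rintro i ⟨h, g⟩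
    have : b i ∈ M := by
      have : b i ∈ AddSubgroup.toIntSubmodule M := hb ▸ Submodule.subset_span ⟨i, rfl⟩
      exact this
    rw [act, (hM _).1 this]; simp
  set W := IntermediateField.adjoin F (Set.range fun i => mon (b i)) with hW
  have monW : ∀ m ∈ M, mon m ∈ W := by
    intro m hm
    have : m ∈ Submodule.span ℤ (Set.range b) := by rw [hb]; exact hm
    induction this using Submodule.span_induction with
    | mem x hx => obtain ⟨i, rfl⟩ := hx; exact IntermediateField.subset_adjoin _ _ ⟨i, rfl⟩
    | zero => rw [mon_zero]; exact one_mem _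
    | add x y hx hy h1 h2 =>
      rw [mon_add]
      rw [hb] at hx hy
      exact mul_mem (h1 hx) (h2 hy)
    | smul k x hx h1 =>
      rw [hb] at hx
      have hx' := h1 hx
      have : mon (k • x) = mon x ^ k := by
        simp only [mon, Pi.smul_apply, smul_eq_mul, ← Finset.prod_zpow]
        refine Finset.prod_congr rfl fun i _ => ?_
        rw [mul_comm, zpow_mul]
      rw [this]
      exact zpow_mem hx' k
  have FE : ∀ (γ : H × G) (x : F), γ • algebraMap F E x = algebraMap F E x := by
    rintro ⟨h, g⟩ x
    rw [IsScalarTower.algebraMap_apply F A E, hA, hF]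
  -- fixed by group
  have Wfix : ∀ x ∈ W, ∀ γ : H × G, γ • x = x := by
    intro x hx γ
    induction hx using IntermediateField.adjoin_induction with
    | mem x hx =>
      obtain ⟨i, rfl⟩ := hx
      have : b i ∈ M := by
        have : b i ∈ AddSubgroup.toIntSubmodule M := hb ▸ Submodule.subset_span ⟨i, rfl⟩
        exact this
      obtain ⟨h, g⟩ := γ
      simp only
      rw [act, (hM _).1 this]; simp
    | algebraMap x => exact FE γ x
    | add x y _ _ h1 h2 => rw [smul_add, h1, h2]
    | inv x _ h1 => rw [smul_inv₀', h1]
    | mul x y _ _ h1 h2 => rw [smul_mul', h1, h2]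
  have algA : Algebra.IsIntegral F A := Algebra.IsInvariant.isIntegral F A G
  let S : Set E := Set.range (algebraMap A E) ∪ Set.range z
  have monsingle : ∀ i k, mon (Pi.single i k) = z i ^ k := by
    intro i k
    simp only [mon]
    rw [Finset.prod_eq_single i]
    · simp
    · intro j _ hj; simp [hj]
    · simp
  have hSalg : ∀ x ∈ S, IsAlgebraic W x := by
    rintro x (⟨y, rfl⟩ | ⟨i, rfl⟩)
    · have h1 : IsIntegral F (algebraMap A E y) := (algA.isIntegral y).algebraMap
      exact (h1.tower_top (A := W)).isAlgebraic
    · have h1 : z i ^ e ∈ W := by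
        have := monW (Pi.single i (e : ℤ)) (by
          rw [hM]
          funext h
          simp only [ch]
          rw [Finset.prod_eq_single i]
          · simp [hce]
          · intro j _ hj; simp [hj]
          · simp)
        rw [monsingle] at this
        simpa using this
      have h2 : IsIntegral W (z i ^ e) := isIntegral_algebraMap (x := (⟨_, h1⟩ : W))
      exact (IsIntegral.of_pow he h2).isAlgebraic
  have hadj : Algebra.adjoin W S = ⊤ := by
    have h1 := IntermediateField.adjoin_toSubalgebra_of_isAlgebraic (F := W) (S := S) hSalg
    rw [← h1]
    have : IntermediateField.adjoin W S = ⊤ := by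
      rw [eq_top_iff]
      intro x _
      have hx : x ∈ IntermediateField.adjoin A (Set.range z) := by rw [htop]; trivial
      induction hx using IntermediateField.adjoin_induction with
      | mem x hx => exact IntermediateField.subset_adjoin _ _ (Or.inr hx)
      | algebraMap x => exact IntermediateField.subset_adjoin _ _ (Or.inl ⟨x, rfl⟩)
      | add x y _ _ h1 h2 => exact add_mem (h1 trivial) (h2 trivial)
      | inv x _ h1 => exact inv_mem (h1 trivial)
      | mul x y _ _ h1 h2 => exact mul_mem (h1 trivial) (h2 trivial)
    rw [this]; rfl
  have hmonoid : ∀ x ∈ Submonoid.closure S, ∃ y m, x = algebraMap A E y * mon m := by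
    intro x hx
    induction hx using Submonoid.closure_induction with
    | mem x hx =>
      rcases hx with ⟨y, rfl⟩ | ⟨i, rfl⟩
      · exact ⟨y, 0, by rw [mon_zero, mul_one]⟩
      · exact ⟨1, Pi.single i 1, by rw [monsingle]; simp⟩
    | one => exact ⟨1, 0, by rw [mon_zero]; simp⟩
    | mul x y _ _ h1 h2 =>
      obtain ⟨a1, m1, rfl⟩ := h1
      obtain ⟨a2, m2, rfl⟩ := h2
      exact ⟨a1 * a2, m1 + m2, by rw [mon_add, map_mul]; ring⟩
  let a' : E := algebraMap A E a
  have trA : ∀ y : A, ∃ t : F, algebraMap F A t = ∑ g : G, g • y := by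
    intro y
    refine Algebra.IsInvariant.isInvariant (G := G) _ fun g => ?_
    rw [Finset.smul_sum]
    exact Fintype.sum_equiv (Equiv.mulLeft g) _ _ fun x => by simp [mul_smul]
  have key : ∀ f : E, ∑ γ : H × G, γ • (f * a') ∈ W := by
    intro f
    have hf : f ∈ Submodule.span W (Submonoid.closure S : Set E) := by
      rw [← Algebra.adjoin_eq_span, hadj]; trivial
    induction hf using Submodule.span_induction with
    | mem x hx =>
      obtain ⟨y, m, rfl⟩ := hmonoid x hx
      obtain ⟨t, ht⟩ := trA (y * a)
      have : ∑ γ : H × G, γ • (algebraMap A E y * mon m * a') =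
          algebraMap F E t * ((∑ h : H, algebraMap K E (ch m h)) * mon m) := by
        rw [IsScalarTower.algebraMap_apply F A E, ht, map_sum, Finset.sum_mul (a := mon m),
          Finset.sum_mul_sum, Fintype.sum_prod_type, Finset.sum_comm]
        refine Finset.sum_congr rfl fun g _ => Finset.sum_congr rfl fun h _ => ?_
        have : algebraMap A E y * mon m * a' = algebraMap A E (y * a) * mon m := by
          simp only [a', map_mul]; ring
        rw [this, smul_mul', hA, act]
      rw [this]
      refine mul_mem (W.algebraMap_mem t) ?_
      by_cases hm : m ∈ M
      · refine mul_mem ?_ (monW m hm)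
        rw [(hM m).1 hm]
        simp
      · have : ∑ h : H, algebraMap K E (ch m h) = 0 := by
          rw [← map_sum]
          have := sum_hom_units_eq_zero ((Units.coeHom K).comp
            ({ toFun := ch m
               map_one' := by simp [ch]
               map_mul' := by intro x y; simp [ch, mul_zpow, Finset.prod_mul_distrib] } : H →* Kˣ)) (by
            intro hh
            apply hm
            rw [hM]
            ext h
            have := DFunLike.congr_fun hh h
            simpa using this)
          simp only [MonoidHom.comp_apply, Units.coeHom_apply, MonoidHom.coe_mk, OneHom.coe_mk] at this
          rw [this, map_zero]
        rw [this, zero_mul]; exact zero_mem _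
    | zero => simp
    | add x y _ _ h1 h2 =>
      simp only [add_mul, smul_add, Finset.sum_add_distrib]
      exact add_mem h1 h2
    | smul k x _ h1 =>
      have : ∑ γ : H × G, γ • (k • x * a') = (k : E) * ∑ γ : H × G, γ • (x * a') := by
        rw [Finset.mul_sum]
        refine Finset.sum_congr rfl fun γ _ => ?_
        rw [show k • x * a' = (k : E) * (x * a') by rw [← mul_assoc]; rfl, smul_mul', Wfix _ k.2]
      rw [this]
      exact mul_mem k.2 h1
  intro f hf
  have h1 := key f
  have h2 : ∑ γ : H × G, γ • (f * a') = f * (Nat.card H : E) := by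
    simp only [smul_mul', hf, ← Finset.mul_sum]
    congr 1
    rw [Fintype.sum_prod_type]
    simp only [a', hA]
    simp only [← map_sum, ha]
    simp
  rw [h2] at h1
  have h3 : f = f * (Nat.card H : E) * (Nat.card H : E)⁻¹ := by field_simp
  rw [h3]
  exact mul_mem h1 (inv_mem (natCast_mem _ _))

theorem core' {K F A E G H I : Type*} [Field K] [Field F] [Field A] [Field E]
    [Algebra K E] [Algebra F A] [Algebra A E] [Algebra F E] [IsScalarTower F A E]
    [Group G] [Finite G] [CommGroup H] [Finite H] [Finite I]
    [MulSemiringAction G A] [MulSemiringAction (H × G) E]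
    [Algebra.IsInvariant F A G]
    (hF : ∀ (g : G) (x : F), g • algebraMap F A x = algebraMap F A x)
    (hA : ∀ (h : H) (g : G) (x : A), (h, g) • algebraMap A E x = algebraMap A E (g • x))
    (a : A) (ha : ∀ [Fintype G], ∑ g : G, g • a = 1)
    (hH : (Nat.card H : E) ≠ 0)
    (z : I → E) (c : I → (H →* Kˣ)) (e : ℕ) (he : 0 < e)
    (hce : ∀ (χ : H →* Kˣ) (h : H), (χ h) ^ e = 1)
    (hz : ∀ h g i, ((h, g) : H × G) • z i = algebraMap K E (c i h) * z i)
    (htop : IntermediateField.adjoin A (Set.range z) = ⊤) :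
    ∃ n : ℕ, n ≤ Nat.card I ∧ ∃ w : Fin n → E, (∀ i (γ : H × G), γ • w i = w i) ∧
      ∀ f : E, (∀ γ : H × G, γ • f = f) → f ∈ IntermediateField.adjoin F (Set.range w) := by
  obtain ⟨n, hn, w, h⟩ := core (I := {i // z i ≠ 0}) hF hA a ha hH (fun i => z i) (fun i => i.2)
    (fun i => c i) e he hce (fun h g i => hz h g i) (by
      rw [eq_top_iff, ← htop, IntermediateField.adjoin_le_iff]
      rintro _ ⟨i, rfl⟩
      by_cases hi : z i = 0
      · rw [hi]; exact zero_mem _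
      · exact IntermediateField.subset_adjoin _ _ ⟨⟨i, hi⟩, rfl⟩)
  exact ⟨n, hn.trans (Nat.card_le_card_of_injective _ Subtype.val_injective), w, h⟩

section Concrete

universe u v

theorem noetherAut_X (K : Type*) [Field K] (G : Type*) [Group G] (h g : G) :
    noetherAut K G h (algebraMap (MvPolynomial G K) _ (MvPolynomial.X g)) =
      algebraMap (MvPolynomial G K) _ (MvPolynomial.X (h * g)) := by
  simp [noetherAut]

theorem bigField_hom_ext {K : Type*} [Field K] {G : Type*} {B : Type*} [Field B] [Algebra K B]
    {f g : NoetherBigField K G →ₐ[K] B}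
    (h : ∀ i, f (algebraMap (MvPolynomial G K) _ (MvPolynomial.X i)) =
      g (algebraMap (MvPolynomial G K) _ (MvPolynomial.X i))) : f = g := by
  apply IsLocalization.algHom_ext (nonZeroDivisors (MvPolynomial G K))
  apply MvPolynomial.algHom_ext
  intro i
  exact h i

instance noetherAct (K : Type*) [Field K] (G : Type*) [Group G] :
    MulSemiringAction G (NoetherBigField K G) where
  smul h x := noetherAut K G h x
  one_smul x := by
    have : (noetherAut K G 1 : NoetherBigField K G →ₐ[K] NoetherBigField K G) = AlgHom.id K _ :=
      bigField_hom_ext fun i => by simp [noetherAut_X]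
    exact DFunLike.congr_fun this x
  mul_smul g h x := by
    have : (noetherAut K G (g * h) : NoetherBigField K G →ₐ[K] NoetherBigField K G) =
        (noetherAut K G g : NoetherBigField K G →ₐ[K] NoetherBigField K G).comp
          (noetherAut K G h : NoetherBigField K G →ₐ[K] NoetherBigField K G) :=
      bigField_hom_ext fun i => by simp [noetherAut_X, mul_assoc]
    exact DFunLike.congr_fun this x
  smul_zero h := map_zero (noetherAut K G h)
  smul_add h := map_add (noetherAut K G h)
  smul_one h := map_one (noetherAut K G h)
  smul_mul h := map_mul (noetherAut K G h)

theorem noether_smul_def {K : Type*} [Field K] {G : Type*} [Group G] (h : G)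
    (x : NoetherBigField K G) : h • x = noetherAut K G h x := rfl

/-- the variables -/
def nX (K : Type*) [Field K] {G : Type*} (g : G) : NoetherBigField K G :=
  algebraMap (MvPolynomial G K) _ (MvPolynomial.X g)

theorem smul_nX {K : Type*} [Field K] {G : Type*} [Group G] (h g : G) :
    h • nX K g = nX K (h * g) := noetherAut_X K G h g

theorem smul_K {K : Type*} [Field K] {G : Type*} [Group G] (h : G) (c : K) :
    h • algebraMap K (NoetherBigField K G) c = algebraMap K (NoetherBigField K G) c :=
  (noetherAut K G h).commutes c

theorem nX_injective (K : Type*) [Field K] {G : Type*} : Function.Injective (nX K (G := G)) := by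
  intro a b hab
  exact MvPolynomial.X_injective (IsFractionRing.injective (MvPolynomial G K) _ hab)

instance noetherAlgBig (K : Type*) [Field K] (G : Type*) [Group G] :
    Algebra (NoetherField K G) (NoetherBigField K G) :=
  (noetherSubfield K G).subtype.toAlgebra

instance (K : Type*) [Field K] (G : Type*) [Group G] :
    IsScalarTower K (NoetherField K G) (NoetherBigField K G) :=
  IsScalarTower.of_algebraMap_eq fun _ => rfl

instance (K : Type*) [Field K] (G : Type*) [Group G] :
    Algebra.IsInvariant (NoetherField K G) (NoetherBigField K G) G where
  isInvariant b hb := ⟨⟨b, hb⟩, rfl⟩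

theorem noether_fixed {K : Type*} [Field K] {G : Type*} [Group G] (g : G) (x : NoetherField K G) :
    g • algebraMap (NoetherField K G) (NoetherBigField K G) x =
      algebraMap (NoetherField K G) (NoetherBigField K G) x := x.2 g

theorem noether_trace (K : Type*) [Field K] (G : Type*) [Group G] [Finite G] :
    ∃ a : NoetherBigField K G, ∀ [Fintype G], ∑ g : G, g • a = 1 := by
  have ft := Fintype.ofFinite G
  have h1 := linearIndependent_monoidHom (NoetherBigField K G) (NoetherBigField K G)
  let f : G → (NoetherBigField K G →* NoetherBigField K G) :=
    fun g => (noetherAut K G g : NoetherBigField K G →* NoetherBigField K G)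
  have hf : Function.Injective f := by
    intro g g' h
    have := DFunLike.congr_fun h (nX K (1 : G))
    have h2 : g • nX K (1 : G) = g' • nX K (1 : G) := this
    rw [smul_nX, smul_nX] at h2
    simpa using nX_injective K h2
  have h2 := h1.comp f hf
  rw [Fintype.linearIndependent_iff] at h2
  have h3 : ∃ b : NoetherBigField K G, ∑ g : G, g • b ≠ 0 := by
    by_contra hcon
    push Not at hcon
    have := h2 (fun _ => 1) (by
      funext b
      have := hcon b
      simpa [f, noether_smul_def] using this) 1
    exact one_ne_zero this
  obtain ⟨b, hb⟩ := h3
  refine ⟨b * (∑ g : G, g • b)⁻¹, fun {inst} => ?_⟩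
  have : inst = ft := Subsingleton.elim _ _
  subst this
  have hfix : ∀ g : G, g • (∑ g : G, g • b) = ∑ g : G, g • b := by
    intro g
    rw [Finset.smul_sum]
    exact Fintype.sum_equiv (Equiv.mulLeft g) _ _ fun x => by simp [mul_smul]
  simp only [smul_mul', smul_inv₀', hfix]
  rw [← Finset.sum_mul, mul_inv_cancel₀ hb]

theorem noether_isIntegral (K : Type*) [Field K] (G : Type*) [Group G] [Finite G] :
    Algebra.IsIntegral (NoetherField K G) (NoetherBigField K G) :=
  Algebra.IsInvariant.isIntegral _ _ G

theorem noether_trdeg (K : Type*) [Field K] (G : Type*) [Group G] [Finite G] :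
    Algebra.trdeg K (NoetherField K G) = (Nat.card G : Cardinal) := by
  have h1 := trdeg_add_eq K (NoetherField K G) (A := NoetherBigField K G)
  have h2 := trdeg_add_eq K (MvPolynomial G K) (A := NoetherBigField K G)
  have := noether_isIntegral K G
  have i1 : Algebra.IsAlgebraic (NoetherField K G) (NoetherBigField K G) := inferInstance
  have i2 : Algebra.IsAlgebraic (MvPolynomial G K) (NoetherBigField K G) :=
    IsLocalization.isAlgebraic _ (nonZeroDivisors (MvPolynomial G K))
  rw [trdeg_eq_zero (R := NoetherField K G), add_zero] at h1
  rw [trdeg_eq_zero (R := MvPolynomial G K), add_zero, MvPolynomial.trdeg_of_isDomain] at h2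
  rw [h1, ← h2, ← Nat.cast_card]
  simp

/-- the embedding on polynomials -/
def phiPoly (K : Type*) [Field K] (G H : Type*) [Fintype H] :
    MvPolynomial G K →ₐ[K] MvPolynomial (H × G) K :=
  MvPolynomial.aeval fun g => ∑ h : H, MvPolynomial.X (h, g)

theorem phiPoly_inj (K : Type*) [Field K] (G H : Type*) [Fintype H] [One H] :
    Function.Injective (phiPoly K G H) := by
  classical
  let ψ : MvPolynomial (H × G) K →ₐ[K] MvPolynomial G K :=
    MvPolynomial.aeval fun p => if p.1 = 1 then MvPolynomial.X p.2 else 0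
  have : ψ.comp (phiPoly K G H) = AlgHom.id K _ := by
    apply MvPolynomial.algHom_ext
    intro g
    simp [ψ, phiPoly]
  intro a b hab
  have h2 := congrArg ψ hab
  rwa [← AlgHom.comp_apply, ← AlgHom.comp_apply, this] at h2

/-- the embedding on big fields -/
def phi (K : Type*) [Field K] (G H : Type*) [Fintype H] [One H] :
    NoetherBigField K G →ₐ[K] NoetherBigField K (H × G) :=
  IsFractionRing.liftAlgHom
    (g := (IsScalarTower.toAlgHom K (MvPolynomial (H × G) K) (NoetherBigField K (H × G))).comp
      (phiPoly K G H))
    ((IsFractionRing.injective (MvPolynomial (H × G) K) (NoetherBigField K (H × G))).comp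
      (phiPoly_inj K G H))

theorem phi_X (K : Type*) [Field K] (G H : Type*) [Fintype H] [One H] (g : G) :
    phi K G H (nX K g) = ∑ h : H, nX K (h, g) := by
  simp [phi, nX, phiPoly]

theorem phi_equiv (K : Type*) [Field K] (G H : Type*) [Group G] [Group H] [Fintype H]
    (h : H) (g : G) (x : NoetherBigField K G) :
    (h, g) • phi K G H x = phi K G H (g • x) := by
  have : ((noetherAut K (H × G) (h, g)) : _ →ₐ[K] _).comp (phi K G H) =
      (phi K G H).comp (noetherAut K G g : _ →ₐ[K] _) := by
    refine bigField_hom_ext fun i => ?_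
    change (h, g) • phi K G H (nX K i) = phi K G H (g • nX K i)
    rw [smul_nX, phi_X, phi_X, Finset.smul_sum]
    simp only [smul_nX, Prod.mk_mul_mk]
    exact Fintype.sum_equiv (Equiv.mulLeft h) _ _ fun x => by simp
  exact DFunLike.congr_fun this x

theorem dual_orth (K : Type*) [Field K] (H : Type*) [CommGroup H] [Finite H]
    [HasEnoughRootsOfUnity K (Monoid.exponent H)] [Fintype (H →* Kˣ)] (h : H) (hh : h ≠ 1) :
    ∑ χ : H →* Kˣ, ((χ h : Kˣ) : K) = 0 := by
  obtain ⟨χ, hχ⟩ := CommGroup.exists_apply_ne_one_of_hasEnoughRootsOfUnity H K hh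
  have := sum_hom_units_eq_zero ((Units.coeHom K).comp (MonoidHom.eval h : (H →* Kˣ) →* Kˣ)) (by
    intro hcon
    have h1 := DFunLike.congr_fun hcon χ
    apply hχ
    ext
    exact h1)
  exact this


/-- eigenvariables -/
def yv {K : Type*} [Field K] {G H : Type*} [Group H] [Fintype H] (χ : H →* Kˣ) (g : G) :
    NoetherBigField K (H × G) :=
  ∑ h : H, algebraMap K (NoetherBigField K (H × G)) ((χ h)⁻¹ : Kˣ) * nX K (h, g)

theorem smul_yv {K : Type*} [Field K] {G H : Type*} [Group G] [Group H] [Fintype H]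
    (χ : H →* Kˣ) (g g' : G) (h' : H) :
    (h', g') • yv χ g = algebraMap K (NoetherBigField K (H × G)) (χ h') * yv χ (g' * g) := by
  simp only [yv, Finset.smul_sum, smul_mul', smul_nX, smul_K, Prod.mk_mul_mk, Finset.mul_sum]
  refine Fintype.sum_equiv (Equiv.mulLeft h') _ _ fun x => ?_
  simp only [Equiv.coe_mulLeft]
  rw [← mul_assoc, ← map_mul, ← Units.val_mul]
  simp

theorem yv_one {K : Type*} [Field K] {G H : Type*} [Group H] [Fintype H] (g : G) :
    yv (1 : H →* Kˣ) g = phi K G H (nX K g) := by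
  rw [phi_X, yv]; simp

theorem sum_yv {K : Type*} [Field K] {G H : Type*} [CommGroup H] [Fintype H]
    [HasEnoughRootsOfUnity K (Monoid.exponent H)] [Fintype (H →* Kˣ)] (h : H) (g : G) :
    ∑ χ : H →* Kˣ, algebraMap K (NoetherBigField K (H × G)) (χ h) * yv χ g =
      (Nat.card H : NoetherBigField K (H × G)) * nX K (h, g) := by
  classical
  simp only [yv, Finset.mul_sum]
  rw [Finset.sum_comm]
  have : ∀ h' : H, ∑ χ : H →* Kˣ, algebraMap K (NoetherBigField K (H × G)) (χ h) *
      (algebraMap K (NoetherBigField K (H × G)) ((χ h')⁻¹ : Kˣ) * nX K (h', g)) =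
      if h' = h then (Nat.card H : NoetherBigField K (H × G)) * nX K (h, g) else 0 := by
    intro h'
    have h1 : ∀ χ : H →* Kˣ, algebraMap K (NoetherBigField K (H × G)) (χ h) *
      (algebraMap K (NoetherBigField K (H × G)) ((χ h')⁻¹ : Kˣ) * nX K (h', g)) =
      algebraMap K (NoetherBigField K (H × G)) (χ (h * h'⁻¹)) * nX K (h', g) := by
      intro χ
      rw [← mul_assoc, ← map_mul, ← Units.val_mul, map_mul, map_inv]
    simp only [h1]
    rw [← Finset.sum_mul, ← map_sum]
    split_ifs with hh
    · subst hh
      simp only [mul_inv_cancel, map_one, Units.val_one, Finset.sum_const, Finset.card_univ]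
      rw [← Nat.card_eq_fintype_card, CommGroup.card_monoidHom_of_hasEnoughRootsOfUnity]
      simp
    · rw [dual_orth, map_zero, zero_mul]
      intro hcon
      exact hh (mul_inv_eq_one.1 hcon).symm
  simp only [this]
  simp

/-- G-invariant eigenvariables -/
def zv {K : Type*} [Field K] {G H : Type*} [Group H] [Fintype H] [Fintype G]
    (χ : H →* Kˣ) (j : ℕ) : NoetherBigField K (H × G) :=
  ∑ g : G, phi K G H (nX K g) ^ j * yv χ g

theorem smul_zv {K : Type*} [Field K] {G H : Type*} [Group G] [Group H] [Fintype H] [Fintype G]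
    (χ : H →* Kˣ) (j : ℕ) (g' : G) (h' : H) :
    (h', g') • (zv χ j : NoetherBigField K (H × G)) =
      algebraMap K (NoetherBigField K (H × G)) (χ h') * zv χ j := by
  simp only [zv, Finset.smul_sum, smul_mul', smul_pow', phi_equiv, smul_nX, smul_yv,
    Finset.mul_sum]
  refine Fintype.sum_equiv (Equiv.mulLeft g') _ _ fun x => ?_
  simp only [Equiv.coe_mulLeft]
  ring

theorem yv_eq {K : Type*} [Field K] {G H : Type*} [Group H] [Fintype H] [Fintype G]
    (χ : H →* Kˣ) (g : G) :
    ∃ b : Fin (Nat.card G) → NoetherBigField K G,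
      yv χ g = ∑ j : Fin (Nat.card G), phi K G H (b j) * zv χ (j : ℕ) := by
  classical
  let eG : Fin (Nat.card G) ≃ G := (Finite.equivFin G).symm
  let V : Matrix (Fin (Nat.card G)) (Fin (Nat.card G)) (NoetherBigField K G) :=
    Matrix.vandermonde fun i => nX K (eG i)
  have hV : IsUnit V.det := by
    rw [isUnit_iff_ne_zero, Matrix.det_vandermonde_ne_zero_iff]
    exact (nX_injective K).comp eG.injective
  refine ⟨fun j => V⁻¹ j (eG.symm g), ?_⟩
  have hz : ∀ j : ℕ, (zv χ j : NoetherBigField K (H × G)) =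
      ∑ i, phi K G H (nX K (eG i) ^ j) * yv χ (eG i) := by
    intro j
    rw [zv]
    refine (Fintype.sum_equiv eG _ _ fun x => ?_).symm
    rw [map_pow]
  simp only [hz, Finset.mul_sum]
  rw [Finset.sum_comm]
  have : ∀ i, ∑ j : Fin (Nat.card G), phi K G H (V⁻¹ j (eG.symm g)) *
      (phi K G H (nX K (eG i) ^ (j : ℕ)) * yv χ (eG i)) =
      if i = eG.symm g then yv χ g else 0 := by
    intro i
    have h1 : (V * V⁻¹) i (eG.symm g) = if i = eG.symm g then 1 else 0 := by
      rw [Matrix.mul_nonsing_inv _ hV, Matrix.one_apply]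
    rw [Matrix.mul_apply] at h1
    have h2 := congrArg (phi K G H) h1
    rw [map_sum] at h2
    simp only [← mul_assoc, ← map_mul]
    rw [← Finset.sum_mul]
    have h3 : ∑ j : Fin (Nat.card G), phi K G H (V⁻¹ j (eG.symm g) * nX K (eG i) ^ (j : ℕ)) =
        phi K G H (if i = eG.symm g then 1 else 0) := by
      rw [← h2]
      refine Finset.sum_congr rfl fun j _ => ?_
      rw [mul_comm]
      rfl
    rw [h3]
    split_ifs with hi
    · subst hi; simp
    · simp
  simp only [this]
  simp

theorem subfield_top {K : Type*} [Field K] {G : Type*} (T : Subfield (NoetherBigField K G))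
    (hK : ∀ c, algebraMap K _ c ∈ T) (hX : ∀ g, nX K g ∈ T) (x : NoetherBigField K G) : x ∈ T := by
  have hp : ∀ p : MvPolynomial G K, algebraMap _ (NoetherBigField K G) p ∈ T := by
    intro p
    induction p using MvPolynomial.induction_on with
    | C a => exact hK a
    | add p q hp hq => rw [map_add]; exact add_mem hp hq
    | mul_X p i hp => rw [map_mul]; exact mul_mem hp (hX i)
  obtain ⟨p, q, _, rfl⟩ := IsFractionRing.div_surjective (A := MvPolynomial G K) x
  exact div_mem (hp p) (hp q)

theorem rational_of_gen {F L : Type*} [Field F] [Field L] [Algebra F L] (n : ℕ) (w : Fin n → L)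
    (hw : IntermediateField.adjoin F (Set.range w) = ⊤)
    (hn : (n : Cardinal) ≤ Algebra.trdeg F L) : IsRationalExtension F L := by
  have halg : Algebra.IsAlgebraic (Algebra.adjoin F (Set.range w)) L := by
    refine ⟨fun x => ?_⟩
    have hx : x ∈ IntermediateField.adjoin F (Set.range w) := by rw [hw]; trivial
    rw [IntermediateField.mem_adjoin_iff_div] at hx
    obtain ⟨r, hr, s, hs, rfl⟩ := hx
    have h1 : IsAlgebraic (Algebra.adjoin F (Set.range w)) r :=
      isAlgebraic_algebraMap (⟨r, hr⟩ : Algebra.adjoin F (Set.range w))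
    have h2 : IsAlgebraic (Algebra.adjoin F (Set.range w)) s :=
      isAlgebraic_algebraMap (⟨s, hs⟩ : Algebra.adjoin F (Set.range w))
    rw [div_eq_mul_inv]
    exact h1.mul h2.inv
  have hb : IsTranscendenceBasis F w :=
    Algebra.IsAlgebraic.isTranscendenceBasis_of_lift_le_trdeg_of_finite F w (by simpa using hn)
  refine ⟨n, ⟨?_⟩⟩
  have e1 := hb.1.aevalEquivField
  rw [hw] at e1
  exact (e1.trans IntermediateField.topEquiv).symm

theorem card_ne_zero_of_prim (K : Type*) [Field K] (H : Type*) [CommGroup H] [Finite H]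
    (ζ : K) (hζ : IsPrimitiveRoot ζ (Monoid.exponent H)) : (Nat.card H : K) ≠ 0 := by
  have hne : NeZero (Monoid.exponent H) := ⟨Monoid.exponent_ne_zero_of_finite⟩
  have h1 : ((Monoid.exponent H : ℕ) : K) ≠ 0 := (hζ.neZero').out
  obtain ⟨k, hk⟩ := card_dvd_exponent_pow_rank H
  intro h0
  have h2 := congrArg (Nat.cast : ℕ → K) hk
  rw [Nat.cast_pow, Nat.cast_mul, h0, zero_mul] at h2
  exact pow_ne_zero _ h1 h2

end Concrete

/-- Theorem 1.1: if `H` is a finite abelian group of exponent `e` and `K` contains a primitive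
`e`-th root of unity, then there is a `K`-embedding of `K(G)` into `K(H × G)` making
`K(H × G)` rational over (the image of) `K(G)`. -/
theorem noether_rational_over_direct_factor_abelian
    (K : Type*) [Field K] (G : Type*) [Group G] [Finite G]
    (H : Type*) [CommGroup H] [Finite H] (e : ℕ)
    (he : Monoid.exponent H = e) (ζ : K) (hζ : IsPrimitiveRoot ζ e) :
    ∃ ι : NoetherField K G →ₐ[K] NoetherField K (H × G),
      @IsRationalExtension (NoetherField K G) (NoetherField K (H × G)) _ _
        ι.toRingHom.toAlgebra := by
  classical
  subst he
  have ftH := Fintype.ofFinite H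
  have ftG := Fintype.ofFinite G
  have hne : NeZero (Monoid.exponent H) := ⟨Monoid.exponent_ne_zero_of_finite⟩
  have hroots : HasEnoughRootsOfUnity K (Monoid.exponent H) := ⟨⟨ζ, hζ⟩, inferInstance⟩
  have hcard := CommGroup.card_monoidHom_of_hasEnoughRootsOfUnity H K
  have finD : Finite (H →* Kˣ) :=
    Nat.finite_of_card_ne_zero (by rw [hcard]; exact Nat.card_pos.ne')
  have ftD := Fintype.ofFinite (H →* Kˣ)
  have hHK := card_ne_zero_of_prim K H ζ hζ
  have hHE : (Nat.card H : NoetherBigField K (H × G)) ≠ 0 := by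
    have := (map_ne_zero (algebraMap K (NoetherBigField K (H × G)))).2 hHK
    simpa using this
  let ι : NoetherField K G →ₐ[K] NoetherField K (H × G) :=
    { toFun := fun x => ⟨phi K G H x.1, by
        rintro ⟨h, g⟩
        have := phi_equiv K G H h g x.1
        rw [show g • x.1 = x.1 from x.2 g] at this
        exact this⟩
      map_one' := Subtype.ext (map_one (phi K G H))
      map_zero' := Subtype.ext (map_zero (phi K G H))
      map_mul' := fun x y => Subtype.ext (map_mul (phi K G H) x.1 y.1)
      map_add' := fun x y => Subtype.ext (map_add (phi K G H) x.1 y.1)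
      commutes' := fun c => Subtype.ext ((phi K G H).commutes c) }
  refine ⟨ι, ?_⟩
  let algFB : Algebra (NoetherField K G) (NoetherField K (H × G)) := ι.toRingHom.toAlgebra
  let algAE : Algebra (NoetherBigField K G) (NoetherBigField K (H × G)) :=
    (phi K G H).toRingHom.toAlgebra
  let algFE : Algebra (NoetherField K G) (NoetherBigField K (H × G)) :=
    ((phi K G H).toRingHom.comp (algebraMap (NoetherField K G) (NoetherBigField K G))).toAlgebra
  have t1 : IsScalarTower (NoetherField K G) (NoetherBigField K G) (NoetherBigField K (H × G)) :=
    IsScalarTower.of_algebraMap_eq fun _ => rfl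
  have t2 : IsScalarTower (NoetherField K G) (NoetherField K (H × G))
      (NoetherBigField K (H × G)) := IsScalarTower.of_algebraMap_eq fun _ => rfl
  have t3 : IsScalarTower K (NoetherField K G) (NoetherField K (H × G)) :=
    IsScalarTower.of_algebraMap_eq fun c => (ι.commutes c).symm
  obtain ⟨a, ha⟩ := noether_trace K G
  let I : Type _ := {χ : H →* Kˣ // χ ≠ 1} × Fin (Nat.card G)
  let z : I → NoetherBigField K (H × G) := fun i => zv i.1.1 (i.2 : ℕ)
  have htop : IntermediateField.adjoin (NoetherBigField K G) (Set.range z) = ⊤ := by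
    rw [eq_top_iff]
    intro x _
    set T := IntermediateField.adjoin (NoetherBigField K G) (Set.range z) with hT
    have hphi : ∀ y, phi K G H y ∈ T := fun y => T.algebraMap_mem y
    have hK : ∀ c, algebraMap K (NoetherBigField K (H × G)) c ∈ T := by
      intro c
      rw [← (phi K G H).commutes c]
      exact hphi _
    have hy : ∀ (χ : H →* Kˣ) (g : G), yv χ g ∈ T := by
      intro χ g
      by_cases hχ : χ = 1
      · rw [hχ, yv_one]; exact hphi _
      · obtain ⟨b, hb⟩ := yv_eq χ g
        rw [hb]
        refine sum_mem fun j _ => mul_mem (hphi _) ?_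
        exact IntermediateField.subset_adjoin _ _ ⟨(⟨χ, hχ⟩, j), rfl⟩
    have hx : ∀ p : H × G, nX K p ∈ T := by
      rintro ⟨h, g⟩
      have h1 := sum_yv (K := K) h g
      have h2 : nX K (h, g) = (Nat.card H : NoetherBigField K (H × G))⁻¹ *
          ∑ χ : H →* Kˣ, algebraMap K (NoetherBigField K (H × G)) (χ h) * yv χ g := by
        rw [h1, inv_mul_cancel_left₀ hHE]
      rw [h2]
      exact mul_mem (inv_mem (natCast_mem _ _)) (sum_mem fun χ _ => mul_mem (hK _) (hy _ _))
    exact subfield_top T.toSubfield hK hx x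
  obtain ⟨n, hn, w, hw, hgen⟩ := core' (K := K) (F := NoetherField K G) (A := NoetherBigField K G)
    (E := NoetherBigField K (H × G)) (G := G) (H := H) (I := I)
    noether_fixed (phi_equiv K G H) a ha hHE z (fun i => i.1.1) (Monoid.exponent H)
    (Nat.pos_of_ne_zero hne.out)
    (fun χ h => by rw [← map_pow, Monoid.pow_exponent_eq_one, map_one])
    (fun h g i => smul_zv _ _ _ _) htop
  let w' : Fin n → NoetherField K (H × G) := fun i => ⟨w i, hw i⟩
  refine rational_of_gen n w' ?_ ?_
  · rw [eq_top_iff]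
    intro x _
    have hx := hgen x.1 (fun γ => x.2 γ)
    let f : NoetherField K (H × G) →ₐ[NoetherField K G] NoetherBigField K (H × G) :=
      IsScalarTower.toAlgHom _ _ _
    have hr : Set.range w = f '' Set.range w' := by
      rw [← Set.range_comp]; rfl
    rw [hr, ← IntermediateField.adjoin_map] at hx
    obtain ⟨y, hy, hyx⟩ := hx
    have : y = x := Subtype.ext hyx
    rw [← this]
    exact hy
  · have h1 := lift_trdeg_add_eq K (NoetherField K G) (NoetherField K (H × G))
    rw [noether_trdeg, noether_trdeg] at h1
    have h2 : Nat.card G + Nat.card I = Nat.card (H × G) := by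
      have h3 : Nat.card {χ : H →* Kˣ // χ ≠ 1} + 1 = Nat.card H := by
        rw [← hcard, Nat.card_eq_fintype_card, Nat.card_eq_fintype_card,
          Fintype.card_subtype_compl, Fintype.card_subtype_eq]
        exact Nat.sub_add_cancel Fintype.card_pos
      simp only [I]
      rw [Nat.card_prod, Nat.card_prod, ← h3, Nat.card_eq_fintype_card (α := Fin _),
        Fintype.card_fin]
      ring
    rw [← h2] at h1
    simp only [Cardinal.lift_natCast, Nat.cast_add, Cardinal.lift_add] at h1
    have h4 := (Cardinal.add_nat_inj (Nat.card G)).1 ((add_comm _ _).trans (h1.trans (add_comm _ _)))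
    rw [← Cardinal.lift_le, h4]
    simp only [Cardinal.lift_natCast]
    exact_mod_cast hn

end
end

section
/- (Fischer's Theorem) Let G be a finite abelian group of exponent e, and let K be a field containing a primitive e-th root of unity. Then K(G) is rational (purely transcendental) over K. -/
set_option synthInstance.maxHeartbeats 1000000
set_option maxHeartbeats 1000000

noncomputable section

open IntermediateField in
theorem core_rational {K L ι : Type*} [Field K] [Field L] [Algebra K L] [Fintype ι]
    (y : ι → L) (hy : ∀ i, y i ≠ 0) (M : Submodule ℤ (ι → ℤ)) (N : ℕ) (hN : 0 < N)
    (hM : ∀ i, ∃ m ∈ M, ∏ j, y j ^ m j = y i ^ N)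
    (htop : IntermediateField.adjoin K (Set.range y) = ⊤)
    (hcard : (Fintype.card ι : Cardinal) ≤ Algebra.trdeg K L) (F : IntermediateField K L)
    (hF : F = IntermediateField.adjoin K {z : L | ∃ m ∈ M, z = ∏ j, y j ^ m j}) :
    ∃ n : ℕ, Nonempty (F ≃ₐ[K] FractionRing (MvPolynomial (Fin n) K)) := by
  obtain ⟨n, b⟩ := Submodule.basisOfPid (Pi.basisFun ℤ ι) M
  let u : Fin n → L := fun k => ∏ j, y j ^ ((b k : ι → ℤ) j)
  have hFu : F = IntermediateField.adjoin K (Set.range u) := by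
    rw [hF]
    apply le_antisymm
    · rw [IntermediateField.adjoin_le_iff]
      rintro z ⟨m, hm, rfl⟩
      let S : AddSubgroup (ι → ℤ) :=
        { carrier := {m | ∏ j, y j ^ m j ∈ IntermediateField.adjoin K (Set.range u)}
          zero_mem' := by simp [one_mem]
          add_mem' := by
            intro a c ha hc
            simp only [Set.mem_ofPred_eq, Pi.add_apply, zpow_add₀ (hy _), Finset.prod_mul_distrib] at *
            exact mul_mem ha hc
          neg_mem' := by
            intro a ha
            simp only [Set.mem_ofPred_eq, Pi.neg_apply, zpow_neg, Finset.prod_inv_distrib] at *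
            exact inv_mem ha }
      have h1 : (M : Submodule ℤ (ι → ℤ)) ≤ AddSubgroup.toIntSubmodule S := by
        have := b.span_eq
        have h2 : M = Submodule.span ℤ (Set.range fun k => (b k : ι → ℤ)) := by
          have h3 := congrArg (Submodule.map M.subtype) this
          rw [Submodule.map_span, Submodule.map_top, Submodule.range_subtype, ← Set.range_comp] at h3
          exact h3.symm
        rw [h2, Submodule.span_le]
        rintro _ ⟨k, rfl⟩
        exact IntermediateField.subset_adjoin K _ ⟨k, rfl⟩
      exact h1 hm
    · apply IntermediateField.adjoin.mono
      rintro _ ⟨k, rfl⟩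
      exact ⟨b k, (b k).2, rfl⟩
  have halgF : Algebra.IsAlgebraic F L := by
    have h1 : (⊤ : IntermediateField K L) ≤ (algebraicClosure F L).restrictScalars K := by
      rw [← htop, IntermediateField.adjoin_le_iff]
      rintro _ ⟨i, rfl⟩
      change y i ∈ algebraicClosure F L
      rw [mem_algebraicClosure_iff]
      obtain ⟨m, hm, hmi⟩ := hM i
      have h2 : y i ^ N ∈ F := by
        rw [hF]; exact IntermediateField.subset_adjoin K _ ⟨m, hm, hmi.symm⟩
      apply IsAlgebraic.of_pow hN
      exact isAlgebraic_algebraMap (⟨_, h2⟩ : F)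
    refine ⟨fun x => ?_⟩
    have := h1 (IntermediateField.mem_top (x := x))
    exact mem_algebraicClosure_iff.1 this
  have halg : Algebra.IsAlgebraic (Algebra.adjoin K (Set.range u)) L := by
    subst hFu
    exact IntermediateField.isAlgebraic_adjoin_iff_top.1 halgF
  have hn : n ≤ Fintype.card ι := by
    have := b.linearIndependent.map' M.subtype (by simp)
    simpa using this.fintype_card_le_finrank
  have hu : IsTranscendenceBasis K u := by
    apply Algebra.IsAlgebraic.isTranscendenceBasis_of_lift_le_trdeg_of_finite
    have h5 : ((n : ℕ) : Cardinal) ≤ Algebra.trdeg K L := le_trans (by exact_mod_cast hn) hcard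
    have h6 := Cardinal.lift_le.{0}.2 h5
    simpa using h6
  rw [hFu]
  exact ⟨n, ⟨hu.1.aevalEquivField.symm⟩⟩

section
open MvPolynomial

variable {K G : Type*} [Field K] [CommGroup G] [Fintype G]

def fy (χ : G →* Kˣ) : MvPolynomial G K := ∑ g, C ((χ g⁻¹ : Kˣ) : K) * X g

theorem fy_ne (χ : G →* Kˣ) : fy χ ≠ 0 := by
  classical
  intro h
  have := congrArg (coeff (Finsupp.single 1 1)) h
  simp [fy, coeff_sum, coeff_C_mul, coeff_X, Finsupp.single_left_inj] at this

theorem fy_act (χ : G →* Kˣ) (h : G) :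
    rename (Equiv.mulLeft h) (fy χ) = C ((χ h : Kˣ) : K) * fy χ := by
  simp only [fy, map_sum, map_mul, rename_C, rename_X, Finset.mul_sum, Equiv.coe_mulLeft]
  refine Fintype.sum_equiv (Equiv.mulLeft h) _ _ fun g => ?_
  simp only [Equiv.coe_mulLeft, ← mul_assoc, ← C_mul, ← Units.val_mul, ← map_mul]
  simp

theorem fy_sum [Fintype (G →* Kˣ)] (hsep : ∀ g : G, g ≠ 1 → ∃ χ : G →* Kˣ, χ g ≠ 1) (g : G) :
    ∑ χ : G →* Kˣ, C ((χ g : Kˣ) : K) * fy χ = C (Fintype.card (G →* Kˣ) : K) * X g := by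
  classical
  simp only [fy, Finset.mul_sum]
  rw [Finset.sum_comm]
  have key : ∀ a : G, a ≠ 1 → ∑ χ : G →* Kˣ, ((χ a : Kˣ) : K) = 0 := by
    intro a ha
    obtain ⟨χ, hχ⟩ := hsep a ha
    let f : (G →* Kˣ) →* K :=
      { toFun := fun χ => ((χ a : Kˣ) : K), map_one' := by simp, map_mul' := by simp }
    refine sum_hom_units_eq_zero f fun h => hχ ?_
    have := DFunLike.congr_fun h χ
    ext
    simpa [f] using this
  have h2 : ∀ g' : G, ∑ χ : G →* Kˣ, C ((χ g : Kˣ) : K) * (C ((χ g'⁻¹ : Kˣ) : K) * X g')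
      = C (∑ χ : G →* Kˣ, ((χ (g * g'⁻¹) : Kˣ) : K)) * X g' := by
    intro g'
    simp only [map_sum, Finset.sum_mul, ← mul_assoc, C_mul, map_mul, Units.val_mul]
  simp only [h2]
  rw [Finset.sum_eq_single g]
  · simp
  · intro b _ hb
    rw [key, C_0, zero_mul]
    intro h
    exact hb (mul_inv_eq_one.1 h).symm
  · simp

theorem fy_adjoin [Fintype (G →* Kˣ)] (hsep : ∀ g : G, g ≠ 1 → ∃ χ : G →* Kˣ, χ g ≠ 1)
    (hc : (Fintype.card (G →* Kˣ) : K) ≠ 0) (p : MvPolynomial G K) :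
    ∃ P : MvPolynomial (G →* Kˣ) K, p = aeval fy P := by
  have h : p ∈ (aeval fy : MvPolynomial (G →* Kˣ) K →ₐ[K] MvPolynomial G K).range := by
    have hX : ∀ g, X g ∈ (aeval fy : MvPolynomial (G →* Kˣ) K →ₐ[K] MvPolynomial G K).range := by
      intro g
      have h1 : (X g : MvPolynomial G K) = C (Fintype.card (G →* Kˣ) : K)⁻¹ *
          ∑ χ : G →* Kˣ, C ((χ g : Kˣ) : K) * fy χ := by
        rw [fy_sum hsep, ← mul_assoc, ← C_mul, inv_mul_cancel₀ hc, C_1, one_mul]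
      rw [h1]
      refine mul_mem (Subalgebra.algebraMap_mem _ _) (sum_mem fun χ _ =>
        mul_mem (Subalgebra.algebraMap_mem _ _) ⟨X χ, by simp⟩)
    induction p using MvPolynomial.induction_on with
    | C a => exact Subalgebra.algebraMap_mem _ _
    | add p q hp hq => exact add_mem hp hq
    | mul_X p i hp => exact mul_mem hp (hX i)
  obtain ⟨P, hP⟩ := h
  exact ⟨P, hP.symm⟩

theorem noetherAut_algebraMap (h : G) (p : MvPolynomial G K) :
    noetherAut K G h (algebraMap _ _ p) = algebraMap _ _ (rename (Equiv.mulLeft h) p) := by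
  simp [noetherAut]

def fixIF (K G : Type*) [Field K] [CommGroup G] : IntermediateField K (NoetherBigField K G) :=
  { noetherSubfield K G with
    algebraMap_mem' := algebraMap_mem_noetherSubfield K G }

theorem mem_fixIF (z : NoetherBigField K G) :
    z ∈ fixIF K G ↔ ∀ h : G, noetherAut K G h z = z := Iff.rfl

def relLat (K G : Type*) [Field K] [CommGroup G] [Fintype (G →* Kˣ)] :
    Submodule ℤ ((G →* Kˣ) → ℤ) := AddSubgroup.toIntSubmodule
  { carrier := {m | ∀ g : G, ∏ χ : G →* Kˣ, χ g ^ m χ = 1}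
    zero_mem' := by simp
    add_mem' := by
      intro a c ha hc g
      simp only [Pi.add_apply, zpow_add, Finset.prod_mul_distrib]
      rw [ha g, hc g, one_mul]
    neg_mem' := by
      intro a ha g
      simp only [Pi.neg_apply, zpow_neg, Finset.prod_inv_distrib]
      rw [ha g, inv_one] }

theorem mem_relLat [Fintype (G →* Kˣ)] (m : (G →* Kˣ) → ℤ) :
    m ∈ relLat K G ↔ ∀ g : G, ∏ χ : G →* Kˣ, χ g ^ m χ = 1 := Iff.rfl

def fY (χ : G →* Kˣ) : NoetherBigField K G := algebraMap _ _ (fy χ)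

def monF (K G : Type*) [Field K] [CommGroup G] [Fintype G] [Fintype (G →* Kˣ)] :
    IntermediateField K (NoetherBigField K G) :=
  IntermediateField.adjoin K {z | ∃ m ∈ relLat K G, z = ∏ j, fY j ^ m j}

theorem monF_le [Fintype (G →* Kˣ)] : monF K G ≤ fixIF K G := by
  rw [monF, IntermediateField.adjoin_le_iff]
  rintro z ⟨m, hm, rfl⟩ h
  have h1 : ∀ χ : G →* Kˣ, noetherAut K G h (fY χ) = algebraMap K _ ((χ h : Kˣ) : K) * fY χ := by
    intro χ
    rw [fY, noetherAut_algebraMap, fy_act, map_mul, IsScalarTower.algebraMap_apply K (MvPolynomial G K)]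
    rfl
  rw [map_prod]
  simp only [map_zpow₀, h1, mul_zpow, Finset.prod_mul_distrib]
  have h2 : (∏ χ : G →* Kˣ, ((χ h : Kˣ) : K) ^ m χ) = 1 := by
    have := (mem_relLat m).1 hm h
    have := congrArg (Units.val) this
    simpa using this
  have h3 := congrArg (algebraMap K (NoetherBigField K G)) h2
  simp only [map_prod, map_zpow₀, map_one] at h3
  rw [h3, one_mul]

theorem reynolds_mem [Fintype (G →* Kˣ)] (P : MvPolynomial (G →* Kˣ) K) :
    algebraMap _ (NoetherBigField K G) (∑ h : G, rename (Equiv.mulLeft h) (aeval fy P)) ∈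
      monF K G := by
  classical
  simp only [aeval_def, eval₂_eq', map_sum, map_mul, map_prod, map_pow, fy_act, 
    algebraMap_eq, rename_C]
  rw [Finset.sum_comm]
  refine sum_mem fun d _ => ?_
  simp only [mul_pow, Finset.prod_mul_distrib]
  rw [← Finset.mul_sum, ← Finset.sum_mul]
  refine mul_mem (IntermediateField.algebraMap_mem _ _) ?_
  let f : G →* K := (Units.coeHom K).comp (∏ χ : G →* Kˣ, χ ^ d χ)
  have hf : ∀ h, f h = ∏ χ : G →* Kˣ, ((χ h : Kˣ) : K) ^ d χ := by
    intro h
    simp [f, MonoidHom.finsetProd_apply]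
  by_cases h1 : (∏ χ : G →* Kˣ, χ ^ d χ) = 1
  · refine mul_mem (sum_mem fun h _ => prod_mem fun χ _ => pow_mem
      (IntermediateField.algebraMap_mem _ _) _) ?_
    refine IntermediateField.subset_adjoin K _ ⟨fun χ => d χ, ?_, ?_⟩
    · rw [mem_relLat]
      intro g
      have := DFunLike.congr_fun h1 g
      simpa [MonoidHom.finsetProd_apply] using this
    · simp [fY]
  · have h2 : ∑ h, f h = 0 := by
      refine sum_hom_units_eq_zero f fun h => h1 ?_
      ext g
      have := DFunLike.congr_fun h g
      simpa [f] using this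
    have h3 := congrArg (fun c => algebraMap (MvPolynomial G K) (NoetherBigField K G) (C c)) h2
    simp only [hf, map_sum, map_prod, map_pow, map_zero] at h3
    rw [h3, zero_mul]
    exact zero_mem _

theorem fix_le [Fintype (G →* Kˣ)] (hsep : ∀ g : G, g ≠ 1 → ∃ χ : G →* Kˣ, χ g ≠ 1)
    (hc : (Fintype.card (G →* Kˣ) : K) ≠ 0) (hc' : (Fintype.card G : K) ≠ 0) :
    fixIF K G ≤ monF K G := by
  classical
  have hpol : ∀ p : MvPolynomial G K, (∀ h, rename (Equiv.mulLeft h) p = p) →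
      algebraMap _ (NoetherBigField K G) p ∈ monF K G := by
    intro p hp
    obtain ⟨P, hP⟩ := fy_adjoin hsep hc p
    have h1 := reynolds_mem P
    rw [← hP] at h1
    simp only [hp, Finset.sum_const, Finset.card_univ, nsmul_eq_mul, map_mul, map_natCast] at h1
    have h2 : ((Fintype.card G : ℕ) : NoetherBigField K G) ≠ 0 := by
      rw [← map_natCast (algebraMap K (NoetherBigField K G))]
      exact (map_ne_zero _).2 hc'
    have h3 := mul_mem (inv_mem (natCast_mem (monF K G) (Fintype.card G))) h1
    rwa [inv_mul_cancel_left₀ h2] at h3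
  intro z hz
  rw [mem_fixIF] at hz
  obtain ⟨p, q, hq, rfl⟩ := IsFractionRing.div_surjective (A := MvPolynomial G K) z
  have hq0 : q ≠ 0 := nonZeroDivisors.ne_zero hq
  let n : MvPolynomial G K := ∏ h : G, rename (Equiv.mulLeft h) q
  have hinj : Function.Injective (algebraMap (MvPolynomial G K) (NoetherBigField K G)) :=
    IsFractionRing.injective _ _
  have hn0 : n ≠ 0 := Finset.prod_ne_zero_iff.2 fun h _ =>
    (map_ne_zero_iff _ (rename_injective _ (Equiv.injective _))).2 hq0
  have hn : ∀ h, rename (Equiv.mulLeft h) n = n := by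
    intro h
    simp only [n, map_prod, rename_rename]
    refine Fintype.prod_equiv (Equiv.mulLeft h) _ _ fun g => ?_
    congr 2
    ext x
    simp [mul_assoc]
  have hdvd : q ∣ n := by
    have := Finset.dvd_prod_of_mem (fun h : G => rename (Equiv.mulLeft h) q) (Finset.mem_univ 1)
    simpa [n] using this
  obtain ⟨r, hr⟩ := hdvd
  have hqL : algebraMap (MvPolynomial G K) (NoetherBigField K G) q ≠ 0 :=
    (map_ne_zero_iff _ hinj).2 hq0
  have hnL : algebraMap (MvPolynomial G K) (NoetherBigField K G) n ≠ 0 :=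
    (map_ne_zero_iff _ hinj).2 hn0
  have hpr : algebraMap (MvPolynomial G K) (NoetherBigField K G) p / algebraMap _ _ q =
      algebraMap _ _ (p * r) / algebraMap _ _ n := by
    rw [div_eq_div_iff hqL hnL, hr]
    simp only [map_mul]; ring
  rw [hpr] at hz ⊢
  refine div_mem (hpol _ fun h => ?_) (hpol _ hn)
  have h1 := hz h
  rw [map_div₀, noetherAut_algebraMap, noetherAut_algebraMap, hn, div_left_inj' hnL] at h1
  exact hinj h1

theorem fY_top [Fintype (G →* Kˣ)] (hsep : ∀ g : G, g ≠ 1 → ∃ χ : G →* Kˣ, χ g ≠ 1)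
    (hc : (Fintype.card (G →* Kˣ) : K) ≠ 0) :
    IntermediateField.adjoin K (Set.range (fY : (G →* Kˣ) → NoetherBigField K G)) = ⊤ := by
  rw [eq_top_iff]
  intro z _
  have h : ∀ p : MvPolynomial G K, algebraMap _ (NoetherBigField K G) p ∈
      IntermediateField.adjoin K (Set.range (fY : (G →* Kˣ) → NoetherBigField K G)) := by
    intro p
    obtain ⟨P, rfl⟩ := fy_adjoin hsep hc p
    simp only [aeval_def, eval₂_eq', map_sum, map_mul, map_prod, map_pow, algebraMap_eq]
    refine sum_mem fun d _ => mul_mem (IntermediateField.algebraMap_mem _ _)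
      (prod_mem fun χ _ => pow_mem (IntermediateField.subset_adjoin K _ (Set.mem_range_self χ)) _)
  obtain ⟨p, q, hq, rfl⟩ := IsFractionRing.div_surjective (A := MvPolynomial G K) z
  exact div_mem (h p) (h q)

def noetherEquivFix : NoetherField K G ≃ₐ[K] fixIF K G :=
  AlgEquiv.ofRingEquiv (f := (RingEquiv.refl (noetherSubfield K G) : NoetherField K G ≃+* fixIF K G))
    (fun _ => rfl)

theorem card_le_trdeg : (Fintype.card G : Cardinal) ≤ Algebra.trdeg K (NoetherBigField K G) := by
  have h0 : AlgebraicIndependent K (X : G → MvPolynomial G K) := algebraicIndependent_X G K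
  have h1 : AlgebraicIndependent K
      (fun g : G => algebraMap (MvPolynomial G K) (NoetherBigField K G) (X g)) :=
    h0.map' (f := IsScalarTower.toAlgHom K _ _) (IsFractionRing.injective _ _)
  have h2 := h1.lift_cardinalMk_le_trdeg
  rw [Cardinal.mk_fintype] at h2
  simpa using h2

end

/-- Fischer's theorem: if `G` is a finite abelian group of exponent `e` and `K` contains a
primitive `e`-th root of unity, then `K(G)` is rational over `K`. -/
theorem fischer_noether_rational
    (K : Type*) [Field K] (G : Type*) [CommGroup G] [Finite G] (e : ℕ)
    (he : Monoid.exponent G = e) (ζ : K) (hζ : IsPrimitiveRoot ζ e) :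
    IsRationalExtension K (NoetherField K G) := by
  subst he
  have : Fintype G := Fintype.ofFinite G
  have hne : NeZero (Monoid.exponent G) := ⟨Monoid.exponent_ne_zero_of_finite⟩
  have : HasEnoughRootsOfUnity K (Monoid.exponent G) := ⟨⟨ζ, hζ⟩, inferInstance⟩
  obtain ⟨eqv⟩ := CommGroup.monoidHom_mulEquiv_of_hasEnoughRootsOfUnity G K
  let _ : Fintype (G →* Kˣ) := Fintype.ofEquiv G eqv.symm.toEquiv
  have hcard : Fintype.card (G →* Kˣ) = Fintype.card G := Fintype.card_congr eqv.toEquiv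
  have hsep : ∀ g : G, g ≠ 1 → ∃ χ : G →* Kˣ, χ g ≠ 1 := fun g hg =>
    CommGroup.exists_apply_ne_one_of_hasEnoughRootsOfUnity G K hg
  have hc' : (Fintype.card G : K) ≠ 0 := by
    have h1 : ((Monoid.exponent G : ℕ) : K) ≠ 0 := hζ.neZero'.out
    have h2 := _root_.card_dvd_exponent_pow_rank G
    rw [Nat.card_eq_fintype_card] at h2
    have h3 := map_dvd (Nat.castRingHom K) h2
    intro h4
    simp only [Nat.coe_castRingHom, h4, zero_dvd_iff, Nat.cast_pow] at h3
    exact h1 (eq_zero_of_pow_eq_zero h3)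
  have hc : (Fintype.card (G →* Kˣ) : K) ≠ 0 := by rwa [hcard]
  have hfix : fixIF K G = monF K G := le_antisymm (fix_le hsep hc hc') monF_le
  obtain ⟨n, ⟨E⟩⟩ := core_rational (K := K) (L := NoetherBigField K G) (ι := G →* Kˣ) fY
    (fun χ => (map_ne_zero_iff _ (IsFractionRing.injective _ _)).2 (fy_ne χ))
    (relLat K G) (Fintype.card G) Fintype.card_pos
    (by
      classical
      intro χ
      refine ⟨Pi.single χ (Fintype.card G : ℤ), ?_, ?_⟩
      · rw [mem_relLat]
        intro g
        rw [Finset.prod_eq_single χ]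
        · simp [← map_pow]
        · intro b _ hb
          simp [Pi.single_eq_of_ne hb]
        · simp
      · rw [Finset.prod_eq_single χ]
        · simp
        · intro b _ hb
          simp [Pi.single_eq_of_ne hb]
        · simp)
    (fY_top hsep hc) (by rw [hcard]; exact card_le_trdeg) (fixIF K G) hfix
  exact ⟨n, ⟨noetherEquivFix.trans E⟩⟩

end
end

section
/- Let K be any field and n an odd positive integer. Then there exists a K-embedding ι : K(D_n) → K(D_{2n}) such that K(D_{2n}) is rational (purely transcendental) over the subfield ι(K(D_n)). In particular, if K(D_n) is rational over K, then so is K(D_{2n}). -/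
set_option synthInstance.maxHeartbeats 1000000
set_option maxHeartbeats 1000000

noncomputable section

theorem ratl_iff (F L : Type*) [Field F] [Field L] [Algebra F L] :
    IsRationalExtension F L ↔ ∃ (n : ℕ) (t : Fin n → L), AlgebraicIndependent F t ∧
      IntermediateField.adjoin F (Set.range t) = ⊤ := by
  constructor
  · rintro ⟨n, ⟨e⟩⟩
    let x : Fin n → FractionRing (MvPolynomial (Fin n) F) :=
      fun i => algebraMap (MvPolynomial (Fin n) F) _ (MvPolynomial.X i)
    have hx : AlgebraicIndependent F x :=
      (MvPolynomial.algebraicIndependent_X (Fin n) F).map'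
        (f := IsScalarTower.toAlgHom F (MvPolynomial (Fin n) F) (FractionRing (MvPolynomial (Fin n) F)))
        (IsFractionRing.injective _ _)
    refine ⟨n, fun i => e.symm (x i), hx.map' (f := e.symm.toAlgHom) e.symm.injective, ?_⟩
    have htop : IntermediateField.adjoin F (Set.range x) = ⊤ := by
      rw [eq_top_iff]
      rintro y -
      have hp : ∀ p : MvPolynomial (Fin n) F, algebraMap _ (FractionRing (MvPolynomial (Fin n) F)) p ∈
          IntermediateField.adjoin F (Set.range x) := by
        intro p
        induction p using MvPolynomial.induction_on with
        | C a =>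
          have := (IntermediateField.adjoin F (Set.range x)).algebraMap_mem a
          rwa [IsScalarTower.algebraMap_apply F (MvPolynomial (Fin n) F)] at this
        | add p q hp hq => rw [map_add]; exact add_mem hp hq
        | mul_X p i hp =>
          rw [map_mul]
          exact mul_mem hp (IntermediateField.subset_adjoin _ _ ⟨i, rfl⟩)
      obtain ⟨a, b, hb, rfl⟩ := IsFractionRing.div_surjective (A := MvPolynomial (Fin n) F) y
      exact div_mem (hp a) (hp b)
    have := congrArg (IntermediateField.map e.symm.toAlgHom) htop
    rw [IntermediateField.adjoin_map, ← Set.range_comp] at this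
    refine this.trans ?_
    rw [eq_top_iff]
    rintro y -
    exact ⟨e y, trivial, by simp⟩
  · rintro ⟨n, t, ht, htop⟩
    exact ⟨n, ⟨(ht.aevalEquivField.trans ((IntermediateField.equivOfEq htop).trans
      IntermediateField.topEquiv)).symm⟩⟩

theorem top_le_of_tower (K F L : Type*) [Field K] [Field F] [Field L] [Algebra K F] [Algebra F L]
    [Algebra K L] [IsScalarTower K F L] {m n : Type*} (t : n → F) (s : m → L)
    (ht : IntermediateField.adjoin K (Set.range t) = ⊤)
    (hs : IntermediateField.adjoin F (Set.range s) = ⊤) (T : IntermediateField K L)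
    (hTt : ∀ i, algebraMap F L (t i) ∈ T) (hTs : ∀ i, s i ∈ T) : ⊤ ≤ T := by
  have hF : ∀ f : F, algebraMap F L f ∈ T := by
    intro f
    have h3 : (IntermediateField.adjoin K (Set.range t)) ≤
        T.comap (IsScalarTower.toAlgHom K F L) := by
      rw [IntermediateField.adjoin_le_iff]
      rintro _ ⟨i, rfl⟩
      exact hTt i
    rw [ht] at h3
    exact h3 (IntermediateField.mem_top (x := f))
  have h4 : IntermediateField.adjoin F (Set.range s) ≤ T.toSubfield.toIntermediateField hF := by
    rw [IntermediateField.adjoin_le_iff]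
    rintro _ ⟨i, rfl⟩
    exact hTs i
  rw [hs] at h4
  intro y _
  exact h4 (IntermediateField.mem_top (x := y))

theorem ratl_trans (K F L : Type*) [Field K] [Field F] [Field L] [Algebra K F] [Algebra F L]
    [Algebra K L] [IsScalarTower K F L] (h1 : IsRationalExtension K F)
    (h2 : IsRationalExtension F L) : IsRationalExtension K L := by
  rw [ratl_iff] at *
  obtain ⟨n, t, ht, ht'⟩ := h1
  obtain ⟨m, s, hs, hs'⟩ := h2
  have key := ht.sumElim_comp hs
  refine ⟨m + n, _, (key.comp (finSumFinEquiv.symm) finSumFinEquiv.symm.injective), ?_⟩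
  rw [finSumFinEquiv.symm.surjective.range_comp, Set.Sum.elim_range, eq_top_iff]
  have hTt : ∀ i, algebraMap F L (t i) ∈
      IntermediateField.adjoin K (Set.range s ∪ Set.range (algebraMap F L ∘ t)) :=
    fun i => IntermediateField.subset_adjoin _ _ (Or.inr ⟨i, rfl⟩)
  have hTs : ∀ i, s i ∈
      IntermediateField.adjoin K (Set.range s ∪ Set.range (algebraMap F L ∘ t)) :=
    fun i => IntermediateField.subset_adjoin _ _ (Or.inl ⟨i, rfl⟩)
  exact top_le_of_tower K F L t s ht' hs' _ hTt hTs

theorem ratl_of_fintype (F L ι : Type*) [Fintype ι] [Field F] [Field L] [Algebra F L] (t : ι → L)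
    (ht : AlgebraicIndependent F t) (h : IntermediateField.adjoin F (Set.range t) = ⊤) :
    IsRationalExtension F L := by
  rw [ratl_iff]
  refine ⟨Fintype.card ι, t ∘ (Fintype.equivFin ι).symm, ht.comp _ (Equiv.injective _), ?_⟩
  rw [(Equiv.surjective _).range_comp, h]


theorem core_gen (F A E L : Type*) [Field F] [Field A] [Field E] [Field L] [Algebra F A]
    [Algebra F E] [Algebra E L] [Algebra A L] [Algebra F L] [IsScalarTower F E L]
    [IsScalarTower F A L] {ι : Type*} (t : ι → E) (s : L) (hA : Algebra.IsIntegral F A)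
    (p : E) (hp : p ∈ IntermediateField.adjoin F (Set.range t))
    (hs : s ^ 2 = s - algebraMap E L p)
    (hgen : ∀ T : Subfield L, (∀ a : A, algebraMap A L a ∈ T) →
      (∀ i, algebraMap E L (t i) ∈ T) → s ∈ T → T = ⊤)
    (tr : L →ₗ[E] E) (c : L) (hc : tr c = 1)
    (htr : ∀ a k, tr (algebraMap A L a * s ^ k) ∈ IntermediateField.adjoin F (Set.range t)) :
    IntermediateField.adjoin F (Set.range t) = ⊤ := by
  obtain ⟨M, hM⟩ : ∃ M, M = IntermediateField.adjoin F (Set.range t) := ⟨_, rfl⟩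
  have htM : ∀ i, t i ∈ M := fun i => hM ▸ IntermediateField.subset_adjoin _ _ ⟨i, rfl⟩
  rw [← hM] at hp htr ⊢
  let T : Set L := Set.range (algebraMap A L) ∪ {s}
  have hTalg : ∀ x ∈ T, IsAlgebraic M x := by
    rintro x (⟨a, rfl⟩ | rfl)
    · have h1 : IsIntegral F (algebraMap A L a) := (hA.isIntegral a).algebraMap
      exact (h1.tower_top (A := M)).isAlgebraic
    · refine IsIntegral.isAlgebraic ?_
      refine ⟨Polynomial.X ^ 2 - Polynomial.X + Polynomial.C ⟨p, hp⟩, ?_, ?_⟩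
      · monicity!
      · simp only [Polynomial.eval₂_add, Polynomial.eval₂_sub, Polynomial.eval₂_pow,
          Polynomial.eval₂_X, Polynomial.eval₂_C, hs]
        change x - algebraMap E L p - x + algebraMap E L p = 0
        ring
  have htop : IntermediateField.adjoin M T = ⊤ := by
    have := hgen (IntermediateField.adjoin M T).toSubfield
      (fun a => IntermediateField.subset_adjoin _ _ (Or.inl ⟨a, rfl⟩))
      (fun i => (IntermediateField.adjoin M T).algebraMap_mem ⟨t i, htM i⟩)
      (IntermediateField.subset_adjoin _ _ (Or.inr rfl))
    rw [eq_top_iff]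
    intro x _
    have hx : x ∈ (⊤ : Subfield L) := trivial
    rw [← this] at hx
    exact hx
  have halg : Algebra.adjoin M T = ⊤ := by
    rw [← IntermediateField.adjoin_toSubalgebra_of_isAlgebraic hTalg, htop,
      IntermediateField.top_toSubalgebra]
  have hclos : ∀ x ∈ Submonoid.closure T, ∃ a k, x = algebraMap A L a * s ^ k := by
    intro x hx
    induction hx using Submonoid.closure_induction with
    | mem x hx =>
      rcases hx with ⟨a, rfl⟩ | rfl
      · exact ⟨a, 0, by simp⟩
      · exact ⟨1, 1, by simp⟩
    | one => exact ⟨1, 0, by simp⟩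
    | mul x y _ _ hx hy =>
      obtain ⟨a, k, rfl⟩ := hx
      obtain ⟨b, l, rfl⟩ := hy
      exact ⟨a * b, k + l, by rw [map_mul, pow_add]; ring⟩
  have hall : ∀ x : L, tr x ∈ M := by
    intro x
    have hx : x ∈ Submodule.span M (Submonoid.closure T : Set L) := by
      rw [← Algebra.adjoin_eq_span, halg]; trivial
    induction hx using Submodule.span_induction with
    | mem x hx => obtain ⟨a, k, rfl⟩ := hclos x hx; exact htr a k
    | zero => rw [map_zero]; exact zero_mem _
    | add x y _ _ hx hy => rw [map_add]; exact add_mem hx hy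
    | smul m x _ hx =>
      have : m • x = (m : E) • x := rfl
      rw [this, map_smul]
      exact mul_mem m.2 hx
  rw [eq_top_iff]
  intro e _
  have := hall (e • c)
  rwa [map_smul, hc, smul_eq_mul, mul_one] at this

open scoped IntermediateField.algebraAdjoinAdjoin in
theorem core_indep {F : Type*} {E : Type*} [Field F] [Field E] [Algebra F E]
    {ι : Type*} [Finite ι] (t : ι → E)
    (h : IntermediateField.adjoin F (Set.range t) = ⊤) (hd : Algebra.trdeg F E = Nat.card ι) :
    AlgebraicIndependent F t := by
  have : Algebra.IsAlgebraic (Algebra.adjoin F (Set.range t)) E := by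
    have h1 : Algebra.IsAlgebraic (IntermediateField.adjoin F (Set.range t)) E := by
      refine ⟨fun x => ?_⟩
      have hx : x ∈ IntermediateField.adjoin F (Set.range t) := by rw [h]; trivial
      exact isAlgebraic_algebraMap (A := E) (⟨x, hx⟩ : IntermediateField.adjoin F (Set.range t))
    exact (IsFractionRing.comap_isAlgebraic_iff (A := Algebra.adjoin F (Set.range t))
      (K := IntermediateField.adjoin F (Set.range t))).mpr h1
  refine (Algebra.IsAlgebraic.isTranscendenceBasis_of_lift_le_trdeg_of_finite F t ?_).1
  rw [hd]
  simp [Nat.cast_card]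

section infra
variable (K : Type*) [Field K] (G : Type*) [Group G]

instance nfAlg : Algebra (NoetherField K G) (NoetherBigField K G) :=
  RingHom.toAlgebra (noetherSubfield K G).subtype

theorem nf_fixed (x : NoetherField K G) (h : G) :
    noetherAut K G h (algebraMap (NoetherField K G) (NoetherBigField K G) x) =
      algebraMap (NoetherField K G) (NoetherBigField K G) x := x.2 h

theorem nf_lift (y : NoetherBigField K G) (hy : ∀ h, noetherAut K G h y = y) :
    ∃ x : NoetherField K G, algebraMap (NoetherField K G) (NoetherBigField K G) x = y :=
  ⟨⟨y, hy⟩, rfl⟩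

instance nfTower : IsScalarTower K (NoetherField K G) (NoetherBigField K G) :=
  IsScalarTower.of_algebraMap_eq (fun _ => rfl)

/-- The variable `x(g)` -/
def xv (g : G) : NoetherBigField K G :=
  algebraMap (MvPolynomial G K) (NoetherBigField K G) (MvPolynomial.X g)

theorem aut_xv (h g : G) : noetherAut K G h (xv K G g) = xv K G (h * g) := by
  unfold noetherAut xv
  rw [IsFractionRing.algEquivOfAlgEquiv_algebraMap]
  simp

variable {K G} in
theorem big_subfield_top (T : Subfield (NoetherBigField K G))
    (hK : ∀ c : K, algebraMap K (NoetherBigField K G) c ∈ T) (hx : ∀ g, xv K G g ∈ T) :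
    T = ⊤ := by
  rw [eq_top_iff]
  rintro y -
  have hp : ∀ p : MvPolynomial G K, algebraMap _ (NoetherBigField K G) p ∈ T := by
    intro p
    induction p using MvPolynomial.induction_on with
    | C a =>
      have := hK a
      rwa [IsScalarTower.algebraMap_apply K (MvPolynomial G K)] at this
    | add p q hp hq => rw [map_add]; exact add_mem hp hq
    | mul_X p i hp =>
      rw [map_mul]
      exact mul_mem hp (hx i)
  obtain ⟨a, b, hb, rfl⟩ := IsFractionRing.div_surjective (A := MvPolynomial G K) y
  exact div_mem (hp a) (hp b)

variable {K G} in
theorem big_hom_ext {R : Type*} [Field R] (f g : NoetherBigField K G →+* R)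
    (hK : ∀ c : K, f (algebraMap K (NoetherBigField K G) c) = g (algebraMap K _ c))
    (hx : ∀ i, f (xv K G i) = g (xv K G i)) (y : NoetherBigField K G) : f y = g y := by
  have := big_subfield_top (f.eqLocusField g) hK hx
  have hy : y ∈ f.eqLocusField g := by rw [this]; trivial
  exact hy

theorem aut_mul (g h : G) (y : NoetherBigField K G) :
    noetherAut K G (g * h) y = noetherAut K G g (noetherAut K G h y) := by
  refine big_hom_ext (noetherAut K G (g * h) : NoetherBigField K G →+* NoetherBigField K G)
    ((noetherAut K G g : NoetherBigField K G →+* NoetherBigField K G).comp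
      (noetherAut K G h : NoetherBigField K G →+* NoetherBigField K G)) ?_ ?_ y
  · intro c
    simp
  · intro i
    simp [aut_xv, mul_assoc]

theorem aut_one (y : NoetherBigField K G) : noetherAut K G 1 y = y := by
  refine big_hom_ext (noetherAut K G 1 : NoetherBigField K G →+* NoetherBigField K G)
    (RingHom.id _) ?_ ?_ y
  · intro c
    simp
  · intro i
    simp [aut_xv]

/-- the action -/
def nfAction : MulSemiringAction G (NoetherBigField K G) where
  smul g y := noetherAut K G g y
  one_smul := aut_one K G
  mul_smul := aut_mul K G
  smul_zero g := map_zero _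
  smul_add g := map_add _
  smul_one g := map_one _
  smul_mul g := map_mul _

theorem nf_integral [Finite G] :
    Algebra.IsIntegral (NoetherField K G) (NoetherBigField K G) := by
  letI := nfAction K G
  have : Algebra.IsInvariant (NoetherField K G) (NoetherBigField K G) G :=
    ⟨fun b hb => nf_lift K G b hb⟩
  exact Algebra.IsInvariant.isIntegral _ _ G

theorem nf_trdeg [Finite G] : Algebra.trdeg K (NoetherField K G) = Nat.card G := by
  have h1 : Algebra.IsAlgebraic (NoetherField K G) (NoetherBigField K G) :=
    (nf_integral K G).isAlgebraic
  have h2 := trdeg_add_eq K (NoetherField K G) (A := NoetherBigField K G)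
  have h3 := trdeg_add_eq K (MvPolynomial G K) (A := NoetherBigField K G)
  have h4 : Algebra.IsAlgebraic (MvPolynomial G K) (NoetherBigField K G) :=
    (IsFractionRing.comap_isAlgebraic_iff (K := NoetherBigField K G)).mpr inferInstance
  rw [trdeg_eq_zero (R := NoetherField K G), add_zero] at h2
  rw [trdeg_eq_zero (R := MvPolynomial G K), add_zero] at h3
  rw [h2, ← h3, MvPolynomial.trdeg_of_isDomain, ← Nat.cast_card, Cardinal.lift_natCast]

/-- constructor -/
def nfMk (y : NoetherBigField K G) (hy : ∀ h, noetherAut K G h y = y) : NoetherField K G :=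
  ⟨y, hy⟩

theorem nfMk_spec (y : NoetherBigField K G) (hy : ∀ h, noetherAut K G h y = y) :
    algebraMap (NoetherField K G) (NoetherBigField K G) (nfMk K G y hy) = y := rfl

theorem tr_fixed [Fintype G] (y : NoetherBigField K G) (h : G) :
    noetherAut K G h (∑ g : G, noetherAut K G g y) = ∑ g : G, noetherAut K G g y := by
  rw [map_sum]
  simp_rw [← aut_mul]
  exact Fintype.sum_equiv (Equiv.mulLeft h) _ _ (fun _ => by simp)

/-- trace -/
def nfTr [Fintype G] : NoetherBigField K G →ₗ[NoetherField K G] NoetherField K G where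
  toFun y := nfMk K G (∑ g : G, noetherAut K G g y) (tr_fixed K G y)
  map_add' x y := by
    apply (algebraMap (NoetherField K G) (NoetherBigField K G)).injective
    rw [map_add]
    simp only [nfMk_spec, map_add, Finset.sum_add_distrib]
  map_smul' m x := by
    apply (algebraMap (NoetherField K G) (NoetherBigField K G)).injective
    rw [smul_eq_mul, map_mul]
    simp only [nfMk_spec, Algebra.smul_def, map_mul, nf_fixed, Finset.mul_sum, RingHom.id_apply]

theorem nfTr_spec [Fintype G] (y : NoetherBigField K G) :
    algebraMap (NoetherField K G) (NoetherBigField K G) (nfTr K G y) =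
      ∑ g : G, noetherAut K G g y := rfl

theorem sum_ne [Fintype G] : ∑ g : G, xv K G g ≠ 0 := by
  classical
  unfold xv
  rw [← map_sum, Ne, map_eq_zero_iff _ (IsFractionRing.injective _ _)]
  intro h
  have := congrArg (MvPolynomial.eval (fun g : G => if g = 1 then (1 : K) else 0)) h
  simp at this

theorem exists_tr_one [Fintype G] : ∃ c, nfTr K G c = 1 := by
  refine ⟨xv K G 1 / ∑ g : G, xv K G g, ?_⟩
  apply (algebraMap (NoetherField K G) (NoetherBigField K G)).injective
  rw [nfTr_spec, map_one]
  have : ∀ h : G, noetherAut K G h (∑ g : G, xv K G g) = ∑ g : G, xv K G g := by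
    intro h
    rw [map_sum]
    simp_rw [aut_xv]
    exact Fintype.sum_equiv (Equiv.mulLeft h) _ _ (fun _ => rfl)
  simp_rw [map_div₀, this, aut_xv, mul_one]
  rw [← Finset.sum_div, div_self (sum_ne K G)]

end infra

/-- `G = H × ⟨z⟩` with `z` of order two -/
structure DD (H G : Type*) [Group H] [Group G] where
  j : H →* G
  q : G →* H
  z : G
  hz : z * z = 1
  hc : ∀ g, z * g = g * z
  hq : ∀ h, q (j h) = h
  hqz : q z = 1
  hs : ∀ g, g = j (q g) ∨ g = j (q g) * z
  hne : z ≠ 1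

namespace DD
variable {H G : Type*} [Group H] [Group G] (d : DD H G)

theorem j_ne (a b : H) : d.j a ≠ d.j b * d.z := by
  intro h
  have h1 := congrArg d.q h
  rw [map_mul, d.hq, d.hq, d.hqz, mul_one] at h1
  subst h1
  exact d.hne (by simpa using h)

theorem j_inj : Function.Injective d.j := fun a b h => by
  have := congrArg d.q h
  rwa [d.hq, d.hq] at this

theorem q_jz (h : H) : d.q (d.j h * d.z) = h := by rw [map_mul, d.hq, d.hqz, mul_one]

theorem bij : Function.Bijective (Sum.elim (fun h => d.j h) (fun h => d.j h * d.z)) := by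
  constructor
  · rintro (a | a) (b | b) h
    · simpa using d.j_inj h
    · exact absurd h (d.j_ne _ _)
    · exact absurd h.symm (d.j_ne _ _)
    · simp only [Sum.elim_inr, mul_left_inj] at h
      simpa using d.j_inj h
  · intro g
    rcases d.hs g with h | h
    · exact ⟨Sum.inl (d.q g), h.symm⟩
    · exact ⟨Sum.inr (d.q g), h.symm⟩

theorem sum_eq [Fintype H] [Fintype G] {M : Type*} [AddCommMonoid M] (f : G → M) :
    ∑ g, f g = ∑ h, f (d.j h) + ∑ h, f (d.j h * d.z) := by
  rw [← (Equiv.ofBijective _ d.bij).sum_comp f, Fintype.sum_sum_type]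
  rfl

theorem jz_mul (a b : H) : d.j a * d.z * d.j b = d.j (a * b) * d.z := by
  rw [map_mul, mul_assoc, d.hc, mul_assoc]

theorem jz_mul' (a b : H) : d.j a * d.z * (d.j b * d.z) = d.j (a * b) := by
  rw [map_mul, mul_assoc, ← mul_assoc d.z, d.hc, mul_assoc (d.j b), d.hz, mul_one]

variable (K : Type*) [Field K]

/-- x -/
def x (h : H) : NoetherBigField K G := xv K G (d.j h)
/-- y -/
def y (h : H) : NoetherBigField K G := xv K G (d.j h * d.z)

theorem aut_x (a h : H) : noetherAut K G (d.j a) (d.x K h) = d.x K (a * h) := by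
  simp [x, aut_xv]
theorem aut_y (a h : H) : noetherAut K G (d.j a) (d.y K h) = d.y K (a * h) := by
  simp [y, aut_xv, mul_assoc]
theorem autz_x (a h : H) : noetherAut K G (d.j a * d.z) (d.x K h) = d.y K (a * h) := by
  simp only [x, y, aut_xv, jz_mul]
theorem autz_y (a h : H) : noetherAut K G (d.j a * d.z) (d.y K h) = d.x K (a * h) := by
  simp only [x, y, aut_xv, jz_mul']

/-- polynomial map -/
def pol : MvPolynomial H K →ₐ[K] MvPolynomial G K :=
  MvPolynomial.aeval (fun h => MvPolynomial.X (d.j h) + MvPolynomial.X (d.j h * d.z))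

theorem pol_inj : Function.Injective (d.pol K) := by
  classical
  let r : MvPolynomial G K →ₐ[K] MvPolynomial H K :=
    MvPolynomial.aeval (fun g => if g = d.j (d.q g) then MvPolynomial.X (d.q g) else 0)
  have : r.comp (d.pol K) = AlgHom.id K _ := by
    ext1 h
    have h2 : ¬ d.j h * d.z = d.j h := fun h' => d.j_ne h h h'.symm
    simp only [AlgHom.comp_apply, pol, r, MvPolynomial.aeval_X, map_add, d.hq, d.q_jz, if_true,
      if_neg h2, add_zero, AlgHom.id_apply]
  intro a b hab
  have h1 := congrArg r hab
  rw [← AlgHom.comp_apply, ← AlgHom.comp_apply, this] at h1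
  exact h1

/-- composite -/
def polF : MvPolynomial H K →ₐ[K] NoetherBigField K G :=
  (IsScalarTower.toAlgHom K (MvPolynomial G K) (NoetherBigField K G)).comp (d.pol K)

theorem polF_inj : Function.Injective (d.polF K) :=
  (IsFractionRing.injective (MvPolynomial G K) (NoetherBigField K G)).comp (d.pol_inj K)

/-- embedding of big fields -/
def phi : NoetherBigField K H →ₐ[K] NoetherBigField K G :=
  IsFractionRing.liftAlgHom (d.polF_inj K)

theorem phi_xv (h : H) : d.phi K (xv K H h) = d.x K h + d.y K h := by
  unfold phi xv
  rw [IsFractionRing.liftAlgHom_apply]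
  refine (IsFractionRing.lift_algebraMap (d.polF_inj K) _).trans ?_
  simp [polF, pol, x, y, xv]

theorem phi_equiv (g : G) (b : NoetherBigField K H) :
    noetherAut K G g (d.phi K b) = d.phi K (noetherAut K H (d.q g) b) := by
  refine big_hom_ext
    ((noetherAut K G g : NoetherBigField K G →+* NoetherBigField K G).comp
      (d.phi K : NoetherBigField K H →+* NoetherBigField K G))
    ((d.phi K : NoetherBigField K H →+* NoetherBigField K G).comp
      (noetherAut K H (d.q g) : NoetherBigField K H →+* NoetherBigField K H)) ?_ ?_ b
  · intro c
    simp
  · intro h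
    simp only [RingHom.comp_apply, RingHom.coe_coe, aut_xv, phi_xv, map_add]
    rcases d.hs g with hg | hg
    · nth_rw 1 [hg]
      nth_rw 2 [hg]
      rw [aut_x, aut_y]
    · nth_rw 1 [hg]
      nth_rw 2 [hg]
      rw [autz_x, autz_y, add_comm]

/-- the embedding -/
def iota : NoetherField K H →ₐ[K] NoetherField K G where
  toFun f := nfMk K G (d.phi K (algebraMap (NoetherField K H) (NoetherBigField K H) f))
    (fun g => by rw [phi_equiv, nf_fixed])
  map_one' := by
    apply (algebraMap (NoetherField K G) (NoetherBigField K G)).injective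
    simp only [nfMk_spec, map_one]
  map_zero' := by
    apply (algebraMap (NoetherField K G) (NoetherBigField K G)).injective
    simp only [nfMk_spec, map_zero]
  map_mul' a b := by
    apply (algebraMap (NoetherField K G) (NoetherBigField K G)).injective
    simp only [nfMk_spec, map_mul]
  map_add' a b := by
    apply (algebraMap (NoetherField K G) (NoetherBigField K G)).injective
    simp only [nfMk_spec, map_add]
  commutes' c := by
    apply (algebraMap (NoetherField K G) (NoetherBigField K G)).injective
    simp only [nfMk_spec, ← IsScalarTower.algebraMap_apply, AlgHom.commutes]

theorem iota_spec (f : NoetherField K H) :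
    algebraMap (NoetherField K G) (NoetherBigField K G) (d.iota K f) =
      d.phi K (algebraMap (NoetherField K H) (NoetherBigField K H) f) := rfl

end DD

namespace DD
variable {H G : Type*} [Group H] [Group G] [Fintype H] [Fintype G] (d : DD H G)
variable (K : Type*) [Field K]

/-- X -/
def XX : NoetherBigField K G := ∑ h, d.x K h
/-- Y -/
def YY : NoetherBigField K G := ∑ h, d.y K h
/-- s -/
def s : NoetherBigField K G := d.YY K / (d.XX K + d.YY K)

theorem aut_XX (a : H) : noetherAut K G (d.j a) (d.XX K) = d.XX K := by
  simp only [XX, map_sum, aut_x]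
  exact Fintype.sum_equiv (Equiv.mulLeft a) _ _ (fun _ => by simp)
theorem aut_YY (a : H) : noetherAut K G (d.j a) (d.YY K) = d.YY K := by
  simp only [YY, map_sum, aut_y]
  exact Fintype.sum_equiv (Equiv.mulLeft a) _ _ (fun _ => by simp)
theorem autz_XX (a : H) : noetherAut K G (d.j a * d.z) (d.XX K) = d.YY K := by
  simp only [XX, YY, map_sum, autz_x]
  exact Fintype.sum_equiv (Equiv.mulLeft a) _ _ (fun _ => by simp)
theorem autz_YY (a : H) : noetherAut K G (d.j a * d.z) (d.YY K) = d.XX K := by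
  simp only [XX, YY, map_sum, autz_y]
  exact Fintype.sum_equiv (Equiv.mulLeft a) _ _ (fun _ => by simp)

theorem phi_sum : d.phi K (∑ h, xv K H h) = d.XX K + d.YY K := by
  simp only [map_sum, phi_xv, XX, YY, Finset.sum_add_distrib]

theorem XY_ne : d.XX K + d.YY K ≠ 0 := by
  rw [← phi_sum, Ne, map_eq_zero]
  exact sum_ne K H

theorem XX_ne_YY : d.XX K - d.YY K ≠ 0 := by
  classical
  unfold XX YY x y xv
  rw [← map_sum, ← map_sum, ← map_sub, Ne, map_eq_zero_iff _ (IsFractionRing.injective _ _)]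
  intro h
  have := congrArg (MvPolynomial.eval (fun g : G => if g = 1 then (1 : K) else 0)) h
  have h1 : ∀ h, ¬ d.j h * d.z = 1 := fun h h' => d.j_ne 1 h (by rw [h', map_one])
  have h2 : ∀ h, d.j h = 1 ↔ h = 1 := fun h => by
    rw [← map_one d.j]; exact d.j_inj.eq_iff
  simp [h1, h2] at this

theorem aut_s (a : H) : noetherAut K G (d.j a) (d.s K) = d.s K := by
  simp only [s, map_div₀, map_add, aut_XX, aut_YY]

theorem autz_s (a : H) : noetherAut K G (d.j a * d.z) (d.s K) = 1 - d.s K := by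
  simp only [s, map_div₀, map_add, autz_XX, autz_YY]
  have := d.XY_ne K
  have h2 : d.YY K + d.XX K ≠ 0 := by rwa [add_comm]
  field_simp
  ring

theorem s_ne : 1 - 2 * d.s K ≠ 0 := by
  have h1 := d.XX_ne_YY K
  have h2 := d.XY_ne K
  intro h
  apply h1
  unfold s at h
  field_simp at h
  linear_combination h

/-- m -/
def m (h : H) : NoetherBigField K G := (1 - d.s K) ^ 2 * d.y K h + d.s K ^ 2 * d.x K h

theorem aut_m (g : G) (h : H) : noetherAut K G g (d.m K h) = d.m K (d.q g * h) := by
  rcases d.hs g with hg | hg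
  · generalize d.q g = a at hg
    subst hg
    simp only [m, map_add, map_mul, map_pow, map_sub, map_one, aut_s, aut_x, aut_y]
  · generalize d.q g = a at hg
    subst hg
    simp only [m, map_add, map_mul, map_pow, map_sub, map_one, autz_s, autz_x, autz_y]
    ring

/-- t -/
def t' (g : H) : NoetherBigField K G := ∑ h, d.phi K (xv K H (h * g)) * d.m K h

theorem aut_t' (g : G) (g' : H) : noetherAut K G g (d.t' K g') = d.t' K g' := by
  simp only [t', map_sum, map_mul, phi_equiv, aut_m, aut_xv]
  exact Fintype.sum_equiv (Equiv.mulLeft (d.q g)) _ _ (fun _ => by simp [mul_assoc])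

/-- t -/
def t (g : H) : NoetherField K G := nfMk K G (d.t' K g) (fun h => d.aut_t' K h g)

theorem aut_p (g : G) :
    noetherAut K G g (d.s K * (1 - d.s K)) = d.s K * (1 - d.s K) := by
  rcases d.hs g with hg | hg
  · rw [hg]
    simp only [map_mul, map_sub, map_one, aut_s]
  · rw [hg]
    simp only [map_mul, map_sub, map_one, autz_s]
    ring

/-- p -/
def p : NoetherField K G := nfMk K G (d.s K * (1 - d.s K)) (d.aut_p K)

/-- sum of variables -/
def sig : NoetherField K H := nfMk K H (∑ g : H, xv K H g) (fun h => by
  simp only [map_sum, aut_xv]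
  exact Fintype.sum_equiv (Equiv.mulLeft h) _ _ (fun _ => by simp))

theorem sum_t' : ∑ g, d.t' K g = (d.XX K + d.YY K) * ∑ h, d.m K h := by
  unfold t'
  rw [Finset.sum_comm, Finset.mul_sum]
  refine Finset.sum_congr rfl fun h _ => ?_
  rw [← Finset.sum_mul, ← phi_sum, map_sum]
  congr 1
  exact Fintype.sum_equiv (Equiv.mulLeft h) _ _ (fun _ => by simp)

theorem sum_m : ∑ h, d.m K h = (1 - d.s K) ^ 2 * d.YY K + d.s K ^ 2 * d.XX K := by
  simp only [m, Finset.sum_add_distrib, ← Finset.mul_sum, XX, YY]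

theorem p_eq : d.p K = (∑ g, d.t K g) / (d.iota K (sig K (H := H))) ^ 2 := by
  apply (algebraMap (NoetherField K G) (NoetherBigField K G)).injective
  have h1 : algebraMap (NoetherField K G) (NoetherBigField K G) (d.iota K (sig K (H := H))) =
    d.XX K + d.YY K := by rw [iota_spec, ← phi_sum]; rfl
  have h2 := d.XY_ne K
  rw [map_div₀, map_pow, map_sum, h1, p, nfMk_spec]
  simp only [t, nfMk_spec]
  rw [sum_t', sum_m, s]
  field_simp
  ring

/-- group matrix -/
def U : Matrix H H (NoetherBigField K H) := Matrix.of fun g h => xv K H (h * g)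

theorem U_det [DecidableEq H] : (U K (H := H)).det ≠ 0 := by
  have h1 : U K (H := H) = (Matrix.of fun g h : H => (MvPolynomial.X (h * g) : MvPolynomial H K)).map
      (algebraMap (MvPolynomial H K) (NoetherBigField K H)) := rfl
  rw [h1, ← RingHom.mapMatrix_apply, ← RingHom.map_det, Ne,
    map_eq_zero_iff _ (IsFractionRing.injective _ _)]
  intro h
  have := congrArg (MvPolynomial.eval (fun g : H => if g = 1 then (1 : K) else 0)) h
  rw [RingHom.map_det, map_zero] at this
  have h3 : (MvPolynomial.eval (fun g : H => if g = 1 then (1 : K) else 0)).mapMatrix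
      (Matrix.of fun g h : H => (MvPolynomial.X (h * g) : MvPolynomial H K)) =
      (Equiv.inv H).permMatrix K := by
    ext g h
    simp [PEquiv.toMatrix_apply, Equiv.toPEquiv_apply, mul_eq_one_iff_eq_inv, eq_comm]
  rw [h3, Matrix.det_permutation] at this
  rcases Int.units_eq_one_or (Equiv.Perm.sign (Equiv.inv H)) with h4 | h4 <;> simp [h4] at this

theorem gen (T : Subfield (NoetherBigField K G)) (hA : ∀ a, d.phi K a ∈ T)
    (ht : ∀ g, d.t' K g ∈ T) (hs : d.s K ∈ T) : T = ⊤ := by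
  classical
  have hm : ∀ h, d.m K h ∈ T := by
    intro h
    have h1 : d.t' K = ((U K (H := H)).map (d.phi K)).mulVec (d.m K) := by
      ext g
      simp [t', Matrix.mulVec, dotProduct, U]
    have h2 : ((U K (H := H))⁻¹.map (d.phi K)) * ((U K (H := H)).map (d.phi K)) = 1 := by
      rw [← Matrix.map_mul, Matrix.nonsing_inv_mul _ (IsUnit.mk0 _ (U_det K))]
      simp
    have h3 : d.m K = ((U K (H := H))⁻¹.map (d.phi K)).mulVec (d.t' K) := by
      rw [h1, Matrix.mulVec_mulVec, h2, Matrix.one_mulVec]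
    rw [h3]
    exact sum_mem fun g _ => mul_mem (hA _) (ht g)
  have hu : ∀ h, d.x K h + d.y K h ∈ T := fun h => by rw [← phi_xv]; exact hA _
  have hy : ∀ h, d.y K h ∈ T := by
    intro h
    have : d.y K h = (d.m K h - d.s K ^ 2 * (d.x K h + d.y K h)) / (1 - 2 * d.s K) := by
      rw [eq_div_iff (d.s_ne K), m]
      ring
    rw [this]
    have h2 : (2 : NoetherBigField K G) ∈ T := by
      rw [← one_add_one_eq_two]; exact add_mem (one_mem _) (one_mem _)
    exact div_mem (sub_mem (hm h) (mul_mem (pow_mem hs 2) (hu h)))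
      (sub_mem (one_mem _) (mul_mem h2 hs))
  have hx : ∀ h, d.x K h ∈ T := fun h => by
    have := sub_mem (hu h) (hy h)
    rwa [add_sub_cancel_right] at this
  refine big_subfield_top T (fun c => ?_) (fun g => ?_)
  · rw [← AlgHom.commutes (d.phi K) c]; exact hA _
  · rcases d.hs g with hg | hg
    · rw [hg]; exact hx _
    · rw [hg]; exact hy _

theorem pow_mem' (M : Subfield (NoetherField K G)) (hp : d.p K ∈ M) (k : ℕ) :
    ∃ r ∈ M, algebraMap (NoetherField K G) (NoetherBigField K G) r =
      d.s K ^ k + (1 - d.s K) ^ k := by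
  induction k using Nat.strong_induction_on with
  | _ k ih =>
    match k with
    | 0 => exact ⟨1 + 1, add_mem (one_mem _) (one_mem _), by simp⟩
    | 1 => exact ⟨1, one_mem _, by simp⟩
    | k + 2 =>
      obtain ⟨a, ha, ha'⟩ := ih k (by omega)
      obtain ⟨b, hb, hb'⟩ := ih (k + 1) (by omega)
      refine ⟨b - d.p K * a, sub_mem hb (mul_mem hp ha), ?_⟩
      rw [map_sub, map_mul, ha', hb', p, nfMk_spec]
      ring

theorem tr_eq (a : NoetherBigField K H) (k : ℕ) (r : NoetherField K G)
    (hr : algebraMap (NoetherField K G) (NoetherBigField K G) r =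
      d.s K ^ k + (1 - d.s K) ^ k) :
    nfTr K G (d.phi K a * d.s K ^ k) = d.iota K (nfTr K H a) * r := by
  apply (algebraMap (NoetherField K G) (NoetherBigField K G)).injective
  rw [map_mul (algebraMap (NoetherField K G) (NoetherBigField K G)), hr, iota_spec, nfTr_spec,
    nfTr_spec, d.sum_eq, map_sum]
  simp only [map_mul, map_pow, phi_equiv, d.hq, d.q_jz, aut_s, autz_s]
  rw [← Finset.sum_mul, ← Finset.sum_mul]
  ring

theorem rational : @IsRationalExtension (NoetherField K H) (NoetherField K G) _ _
    (d.iota K).toRingHom.toAlgebra := by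
  let _ : Algebra (NoetherField K H) (NoetherField K G) := (d.iota K).toRingHom.toAlgebra
  let _ : Algebra (NoetherBigField K H) (NoetherBigField K G) := (d.phi K).toRingHom.toAlgebra
  let _ : Algebra (NoetherField K H) (NoetherBigField K G) :=
    ((algebraMap (NoetherField K G) (NoetherBigField K G)).comp (d.iota K).toRingHom).toAlgebra
  have i1 : IsScalarTower (NoetherField K H) (NoetherField K G) (NoetherBigField K G) :=
    IsScalarTower.of_algebraMap_eq (fun _ => rfl)
  have i2 : IsScalarTower (NoetherField K H) (NoetherBigField K H) (NoetherBigField K G) :=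
    IsScalarTower.of_algebraMap_eq (fun f => d.iota_spec K f)
  have i3 : IsScalarTower K (NoetherField K H) (NoetherField K G) :=
    IsScalarTower.of_algebraMap_eq (fun c => ((d.iota K).commutes c).symm)
  have hιM : ∀ f, d.iota K f ∈ IntermediateField.adjoin (NoetherField K H) (Set.range (d.t K)) :=
    fun f => IntermediateField.algebraMap_mem _ f
  have hp : d.p K ∈ IntermediateField.adjoin (NoetherField K H) (Set.range (d.t K)) := by
    rw [p_eq]
    exact div_mem (sum_mem fun g _ => IntermediateField.subset_adjoin _ _ ⟨g, rfl⟩)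
      (pow_mem (hιM _) 2)
  obtain ⟨c, hc⟩ := exists_tr_one K G
  have htop := core_gen (NoetherField K H) (NoetherBigField K H) (NoetherField K G)
    (NoetherBigField K G) (d.t K) (d.s K) (nf_integral K H) (d.p K) hp
    (by rw [p, nfMk_spec]; ring) (fun T h1 h2 h3 => d.gen K T h1 h2 h3) (nfTr K G) c hc
    (fun a k => by
      obtain ⟨r, hr, hr'⟩ := d.pow_mem' K
        (IntermediateField.adjoin (NoetherField K H) (Set.range (d.t K))).toSubfield hp k
      have := d.tr_eq K a k r hr'
      exact this ▸ mul_mem (hιM _) hr)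
  refine ratl_of_fintype _ _ _ (d.t K) (core_indep _ htop ?_) htop
  have h1 := lift_trdeg_add_eq K (NoetherField K H) (NoetherField K G)
  rw [nf_trdeg, nf_trdeg] at h1
  have hcard : Nat.card G = Nat.card H + Nat.card H := by
    rw [← Nat.card_congr (Equiv.ofBijective _ d.bij), Nat.card_sum]
  rw [hcard, Cardinal.lift_natCast, Cardinal.lift_natCast, Nat.cast_add] at h1
  have h2 := Cardinal.eq_of_add_eq_add_left h1 (Cardinal.natCast_lt_aleph0)
  simpa using h2

end DD

/-- functoriality -/
def dmap {n m : ℕ} (f : ZMod n →+ ZMod m) : DihedralGroup n →* DihedralGroup m where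
  toFun
    | .r i => .r (f i)
    | .sr i => .sr (f i)
  map_one' := by
    change DihedralGroup.r (f 0) = DihedralGroup.r 0
    rw [map_zero]
  map_mul' := by
    rintro (a | a) (b | b) <;> simp

theorem dmap_r {n m : ℕ} (f : ZMod n →+ ZMod m) (i : ZMod n) :
    dmap f (.r i) = .r (f i) := rfl
theorem dmap_sr {n m : ℕ} (f : ZMod n →+ ZMod m) (i : ZMod n) :
    dmap f (.sr i) = .sr (f i) := rfl

/-- projection -/
def fq (n : ℕ) : ZMod (2 * n) →+ ZMod n :=
  (ZMod.castHom (Dvd.intro_left 2 rfl) (ZMod n)).toAddMonoidHom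

theorem nn (n : ℕ) : (n : ZMod (2 * n)) + n = 0 := by
  have : ((2 * n : ℕ) : ZMod (2 * n)) = 0 := ZMod.natCast_self _
  push_cast at this
  rw [← this]; ring

theorem even_nn (n a : ℕ) (h : Even a) : (a : ZMod (2 * n)) * n = 0 := by
  obtain ⟨b, rfl⟩ := h
  push_cast
  linear_combination (b : ZMod (2 * n)) * nn n

/-- section -/
def fj (n : ℕ) (hn : Odd n) : ZMod n →+ ZMod (2 * n) :=
  ZMod.lift n ⟨zmultiplesHom (ZMod (2 * n)) ((n : ZMod (2 * n)) + 1), by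
    have := even_nn n (n + 1) hn.add_one
    push_cast at this
    simp only [zmultiplesHom_apply, natCast_zsmul, nsmul_eq_mul]
    linear_combination this⟩

theorem fj_nat (n : ℕ) (hn : Odd n) (k : ℕ) : fj n hn (k : ZMod n) = k * (n + 1) := by
  have := ZMod.lift_coe n ⟨zmultiplesHom (ZMod (2 * n)) ((n : ZMod (2 * n)) + 1), by
    have := even_nn n (n + 1) hn.add_one
    push_cast at this
    simp only [zmultiplesHom_apply, natCast_zsmul, nsmul_eq_mul]
    linear_combination this⟩ (k : ℤ)
  simp only [zmultiplesHom_apply, natCast_zsmul, nsmul_eq_mul, Int.cast_natCast] at this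
  exact this

theorem fq_nat (n k : ℕ) : fq n (k : ZMod (2 * n)) = k := 
  map_natCast (ZMod.castHom (Dvd.intro_left 2 rfl) (ZMod n)) k

theorem fq_fj (n : ℕ) [NeZero n] (hn : Odd n) (i : ZMod n) : fq n (fj n hn i) = i := by
  obtain ⟨k, rfl⟩ := ZMod.natCast_zmod_surjective i
  rw [fj_nat]
  have : ((k : ZMod (2 * n)) * (n + 1)) = ((k * (n + 1) : ℕ) : ZMod (2 * n)) := by push_cast; ring
  rw [this, fq_nat]
  simp

theorem fj_fq (n : ℕ) [NeZero n] (hn : Odd n) (i : ZMod (2 * n)) :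
    i = fj n hn (fq n i) ∨ i = fj n hn (fq n i) + n := by
  obtain ⟨k, rfl⟩ := ZMod.natCast_zmod_surjective i
  rw [fq_nat, fj_nat]
  rcases Nat.even_or_odd k with h | h
  · left
    linear_combination - even_nn n k h
  · right
    have := even_nn n (k + 1) h.add_one
    push_cast at this
    linear_combination - this

/-- decomposition of dihedral groups -/
def dihDD (n : ℕ) [NeZero n] (hn : Odd n) : DD (DihedralGroup n) (DihedralGroup (2 * n)) where
  j := dmap (fj n hn)
  q := dmap (fq n)
  z := .r n
  hz := by rw [DihedralGroup.r_mul_r, nn]; rfl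
  hc := by
    rintro (i | i)
    · simp [add_comm]
    · simp only [DihedralGroup.r_mul_sr, DihedralGroup.sr_mul_r, DihedralGroup.sr.injEq]
      linear_combination - nn n
  hq := by
    rintro (i | i)
    · rw [dmap_r, dmap_r, fq_fj]
    · rw [dmap_sr, dmap_sr, fq_fj]
  hqz := by
    rw [dmap_r, fq_nat, ZMod.natCast_self]; rfl
  hs := by
    rintro (i | i)
    · rw [dmap_r, dmap_r, DihedralGroup.r_mul_r, DihedralGroup.r.injEq, DihedralGroup.r.injEq]
      exact fj_fq n hn i
    · rw [dmap_sr, dmap_sr, DihedralGroup.sr_mul_r, DihedralGroup.sr.injEq,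
        DihedralGroup.sr.injEq]
      exact fj_fq n hn i
  hne := by
    rw [DihedralGroup.one_def, Ne, DihedralGroup.r.injEq, ZMod.natCast_eq_zero_iff]
    intro h
    have h1 := Nat.le_of_dvd (Nat.pos_of_ne_zero (NeZero.ne n)) h
    have h2 := Nat.pos_of_ne_zero (NeZero.ne n)
    omega

/-- Theorem 1.5: for any field `K` and odd `n`, there is a `K`-embedding of `K(Dₙ)` into
`K(D₂ₙ)` making `K(D₂ₙ)` rational over (the image of) `K(Dₙ)`; in particular, if `K(Dₙ)` is
rational over `K`, so is `K(D₂ₙ)`. -/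
theorem noether_dihedral_double
    (K : Type*) [Field K] (n : ℕ) (hn : Odd n) (hpos : 0 < n) :
    (∃ ι : NoetherField K (DihedralGroup n) →ₐ[K] NoetherField K (DihedralGroup (2 * n)),
      @IsRationalExtension (NoetherField K (DihedralGroup n))
        (NoetherField K (DihedralGroup (2 * n))) _ _ ι.toRingHom.toAlgebra) ∧
    (IsRationalExtension K (NoetherField K (DihedralGroup n)) →
      IsRationalExtension K (NoetherField K (DihedralGroup (2 * n)))) := by
  have : NeZero n := ⟨hpos.ne'⟩
  have h := (dihDD n hn).rational K
  refine ⟨⟨(dihDD n hn).iota K, h⟩, fun hK => ?_⟩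
  let _ : Algebra (NoetherField K (DihedralGroup n)) (NoetherField K (DihedralGroup (2 * n))) :=
    ((dihDD n hn).iota K).toRingHom.toAlgebra
  have i3 : IsScalarTower K (NoetherField K (DihedralGroup n))
      (NoetherField K (DihedralGroup (2 * n))) :=
    IsScalarTower.of_algebraMap_eq (fun c => (((dihDD n hn).iota K).commutes c).symm)
  exact ratl_trans K (NoetherField K (DihedralGroup n)) _ hK h

end
end
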